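/- Let d, m ≥ 1, r⃗ ∈ (0,∞)^m, q ∈ (0,∞), s ∈ (q,∞], and t⃗ ∈ (0,∞]^m with t_j ≥ r_j for all j and q ≤ t ≤ s, where 1/t := ∑_{j=1}^m 1/t_j. Suppose p⃗ ∈ (0,∞]^m satisfies p_j > r_j for all j and q ≤ p < s where 1/p := ∑_{j=1}^m 1/p_j, let w⃗ ∈ A_{p⃗,(r⃗,s)}, and let f_j ∈ L^{p_j}_{w_j}(ℝ^d) (1 ≤ j ≤ m) and g ∈ L^{(1/q−1/p)^{-1}}_{w^{-1}}(ℝ^d), where w := ∏_{j=1}^m w_j. Then there exists a vector of weights W⃗ ∈ A_{t⃗,(r⃗,s)} with W := ∏_{j=1}^m W_j such that (∏_{j=1}^m ‖f_j‖_{L^{t_j}_{W_j}(ℝ^d)}) · ‖g‖_{L^{(1/q−1/t)^{-1}}_{W^{-1}}(ℝ^d)} ≤ 2^{m²/q} (∏_{j=1}^m ‖f_j‖_{L^{p_j}_{w_j}(ℝ^d)}) · ‖g‖_{L^{(1/q−1/p)^{-1}}_{w^{-1}}(ℝ^d)}, and [W⃗]_{t⃗,(r⃗,s)} ≤ C ·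 [w⃗]_{p⃗,(r⃗,s)}^{max{ max_{1≤j≤m} (1/r_j − 1/t_j)/(1/r_j − 1/p_j), (1/t − 1/s)/(1/p − 1/s) }} for a constant C depending only on d, m, p⃗, r⃗, s, t⃗. -/

import Mathlib

open MeasureTheory ENNReal

noncomputable section

structure Cube (d : ℕ) where
  corner : Fin d → ℝ
  side : ℝ
  side_pos : 0 < side

namespace Cube
def set {d : ℕ} (Q : Cube d) : Set (Fin d → ℝ) :=
  {x | ∀ i, Q.corner i ≤ x i ∧ x i < Q.corner i + Q.side}
def vol {d : ℕ} (Q : Cube d) : ℝ≥0∞ := volume Q.set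
def IsDyadic {d : ℕ} (Q : Cube d) : Prop :=
  ∃ (k : ℤ) (n : Fin d → ℤ), Q.side = (2:ℝ) ^ (-k) ∧ ∀ i, Q.corner i = (2:ℝ) ^ (-k) * (n i : ℝ)
end Cube

def IsSparse {d : ℕ} (S : Set (Cube d)) : Prop :=
  ∃ E : Cube d → Set (Fin d → ℝ),
    (∀ Q ∈ S, MeasurableSet (E Q) ∧ E Q ⊆ Q.set ∧ Q.vol ≤ 2 * volume (E Q)) ∧
    S.PairwiseDisjoint E

def eNorm {α : Type*} [MeasurableSpace α] (p : ℝ≥0∞) (μ : Measure α) (F : α → ℝ≥0∞) : ℝ≥0∞ :=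
  if p = ∞ then essSup F μ else (∫⁻ x, F x ^ p.toReal ∂μ) ^ (1 / p.toReal)

def nn {α : Type*} (f : α → ℂ) : α → ℝ≥0∞ := fun x => (‖f x‖₊ : ℝ≥0∞)

def avg {d : ℕ} (r : ℝ≥0∞) (F : (Fin d → ℝ) → ℝ≥0∞) (Q : Cube d) : ℝ≥0∞ :=
  if r = ∞ then essSup F (volume.restrict Q.set)
  else ((∫⁻ x in Q.set, F x ^ r.toReal) / Q.vol) ^ (1 / r.toReal)

def maximal {d k : ℕ} (r : Fin k → ℝ≥0∞) (F : Fin k → (Fin d → ℝ) → ℝ≥0∞)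
    (x : Fin d → ℝ) : ℝ≥0∞ :=
  ⨆ (Q : Cube d) (_ : x ∈ Q.set), ∏ j, avg (r j) (F j) Q

def maximalX {d k : ℕ} (r : Fin k → ℝ≥0∞) (ρ : ℝ≥0∞) (F : Fin k → (Fin d → ℝ) → ℝ≥0∞)
    (G : (Fin d → ℝ) → ℝ≥0∞) (x : Fin d → ℝ) : ℝ≥0∞ :=
  ⨆ (Q : Cube d) (_ : x ∈ Q.set), (∏ j, avg (r j) (F j) Q) * avg ρ G Q

def wNorm {d : ℕ} (p : ℝ≥0∞) (w : (Fin d → ℝ) → ℝ) (F : (Fin d → ℝ) → ℝ≥0∞) : ℝ≥0∞ :=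
  eNorm p volume (fun x => F x * ENNReal.ofReal (w x))

def aConst {d m : ℕ} (p r : Fin m → ℝ≥0∞) (s : ℝ≥0∞)
    (w : Fin m → (Fin d → ℝ) → ℝ) : ℝ≥0∞ :=
  ⨆ Q : Cube d,
    (∏ j, avg ((r j)⁻¹ - (p j)⁻¹)⁻¹ (fun x => ENNReal.ofReal (w j x)⁻¹) Q) *
      avg ((∑ j, (p j)⁻¹) - s⁻¹)⁻¹ (fun x => ENNReal.ofReal (∏ j, w j x)) Q

def latAvg {d : ℕ} {Ω : Type*} (r : ℝ≥0∞) (f : (Fin d → ℝ) → Ω → ℂ) (Q : Cube d) (ω : Ω) : ℝ≥0∞ :=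
  ((∫⁻ y in Q.set, (‖f y ω‖₊ : ℝ≥0∞) ^ r.toReal) / Q.vol) ^ (1 / r.toReal)

def latMax {d m : ℕ} {Ω : Type*} (r : Fin m → ℝ≥0∞) (D : Finset (Cube d))
    (f : Fin m → (Fin d → ℝ) → Ω → ℂ) (x : Fin d → ℝ) (ω : Ω) : ℝ≥0∞ :=
  ⨆ Q ∈ D, ⨆ (_ : x ∈ Cube.set Q), ∏ j, latAvg (r j) (f j) Q ω

def latMaxX {d m : ℕ} {Ω : Type*} (r : Fin m → ℝ≥0∞) (ρ : ℝ≥0∞) (D : Finset (Cube d))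
    (f : Fin m → (Fin d → ℝ) → Ω → ℂ) (g : (Fin d → ℝ) → Ω → ℂ)
    (x : Fin d → ℝ) (ω : Ω) : ℝ≥0∞ :=
  ⨆ Q ∈ D, ⨆ (_ : x ∈ Cube.set Q), (∏ j, latAvg (r j) (f j) Q ω) * latAvg ρ g Q ω

def MemLinftyC {d : ℕ} (f : (Fin d → ℝ) → ℂ) : Prop :=
  Measurable f ∧ (∃ M : ℝ, ∀ x, ‖f x‖ ≤ M) ∧ Bornology.IsBounded (Function.support f)

def SimpleLinftyC {d : ℕ} (f : (Fin d → ℝ) → ℂ) : Prop :=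
  Measurable f ∧ (Set.range f).Finite ∧ Bornology.IsBounded (Function.support f)

def PairSimple {d : ℕ} {Ω : Type*} [MeasurableSpace Ω] (f : (Fin d → ℝ) → Ω → ℂ) : Prop :=
  Measurable (Function.uncurry f) ∧ (Set.range (Function.uncurry f)).Finite ∧
    ∃ B : Set (Fin d → ℝ), Bornology.IsBounded B ∧ ∀ x ∉ B, ∀ ω, f x ω = 0

def VecSimple {d : ℕ} {Ω : Type*} [MeasurableSpace Ω] (f : (Fin d → ℝ) → Ω → ℂ) : Prop :=
  ∃ (N : ℕ) (A : Fin N → Set (Fin d → ℝ)) (ξ : Fin N → Ω → ℂ),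
    (∀ i, MeasurableSet (A i)) ∧ (∀ i, Bornology.IsBounded (A i)) ∧
    (∀ i, Measurable (ξ i)) ∧ (∃ M : ℝ, ∀ i ω, ‖ξ i ω‖ ≤ M) ∧
    ∀ x ω, f x ω = ∑ i, (A i).indicator (fun _ => ξ i ω) x

namespace Extrap

/-! ### Maximal functions over nested families -/

section Maximal
variable {α ι : Type*} [MeasurableSpace α]

def nested (Q : ι → Set α) : Prop := ∀ i j, Q i ⊆ Q j ∨ Q j ⊆ Q i ∨ Disjoint (Q i) (Q j)

def mavg (μ : Measure α) (Q : Set α) (F : α → ℝ≥0∞) : ℝ≥0∞ := (∫⁻ x in Q, F x ∂μ) / μ Q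

def mmax (μ : Measure α) (Q : ι → Set α) (F : α → ℝ≥0∞) (x : α) : ℝ≥0∞ :=
  ⨆ i, (Q i).indicator (fun _ => mavg μ (Q i) F) x

lemma fin_weak (μ : Measure α) (Q : ι → Set α) (hQ : ∀ i, MeasurableSet (Q i)) (hn : nested Q)
    (F : α → ℝ≥0∞) (l : ℝ≥0∞) (n : ℕ) : ∀ (D : Finset ι), D.card ≤ n →
    (∀ i ∈ D, l * μ (Q i) ≤ ∫⁻ x in Q i, F x ∂μ) →
    l * μ (⋃ i ∈ D, Q i) ≤ ∫⁻ x in ⋃ i ∈ D, Q i, F x ∂μ := by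
  classical
  induction n with
  | zero =>
    intro D hD _
    have : D = ∅ := by simpa using hD
    simp [this]
  | succ n ih =>
    intro D hD h
    rcases D.eq_empty_or_nonempty with rfl | ⟨i, hi⟩
    · simp
    by_cases hex : ∃ j ∈ D, j ≠ i ∧ Q i ⊆ Q j
    · obtain ⟨j, hj, hji, hs⟩ := hex
      have e : (⋃ k ∈ D, Q k) = ⋃ k ∈ D.erase i, Q k := by
        apply Set.Subset.antisymm
        · intro x hx
          simp only [Set.mem_iUnion] at hx ⊢
          obtain ⟨k, hk, hx⟩ := hx
          by_cases hki : k = i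
          · subst hki
            exact ⟨j, Finset.mem_erase.2 ⟨hji, hj⟩, hs hx⟩
          · exact ⟨k, Finset.mem_erase.2 ⟨hki, hk⟩, hx⟩
        · intro x hx
          simp only [Set.mem_iUnion] at hx ⊢
          obtain ⟨k, hk, hx⟩ := hx
          exact ⟨k, Finset.mem_of_mem_erase hk, hx⟩
      rw [e]
      apply ih
      · rw [Finset.card_erase_of_mem hi]; omega
      · intro k hk
        exact h k (Finset.mem_of_mem_erase hk)
    · push Not at hex
      set D' := (D.erase i).filter (fun j => Disjoint (Q i) (Q j)) with hD'
      have e : (⋃ k ∈ D, Q k) = Q i ∪ ⋃ k ∈ D', Q k := by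
        apply Set.Subset.antisymm
        · intro x hx
          simp only [Set.mem_iUnion, Set.mem_union] at hx ⊢
          obtain ⟨k, hk, hx⟩ := hx
          by_cases hki : k = i
          · subst hki; exact Or.inl hx
          · rcases hn i k with h1 | h1 | h1
            · exact absurd h1 (hex k hk hki)
            · exact Or.inl (h1 hx)
            · exact Or.inr ⟨k, Finset.mem_filter.2 ⟨Finset.mem_erase.2 ⟨hki, hk⟩, h1⟩, hx⟩
        · intro x hx
          simp only [Set.mem_iUnion, Set.mem_union] at hx ⊢
          rcases hx with hx | ⟨k, hk, hx⟩
          · exact ⟨i, hi, hx⟩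
          · exact ⟨k, Finset.mem_of_mem_erase (Finset.mem_filter.1 hk).1, hx⟩
      have hm : MeasurableSet (⋃ k ∈ D', Q k) := Finset.measurableSet_biUnion _ (fun k _ => hQ k)
      have hdis : Disjoint (Q i) (⋃ k ∈ D', Q k) := by
        simp only [Set.disjoint_iUnion_right]
        intro k hk
        exact (Finset.mem_filter.1 hk).2
      rw [e, measure_union hdis hm, lintegral_union hm hdis, mul_add]
      apply add_le_add (h i hi)
      apply ih
      · have := Finset.card_filter_le (D.erase i) (fun j => Disjoint (Q i) (Q j))
        rw [Finset.card_erase_of_mem hi] at this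
        have h2 : D'.card ≤ D.card - 1 := this
        omega
      · intro k hk
        exact h k (Finset.mem_of_mem_erase (Finset.mem_filter.1 hk).1)

lemma measurable_mmax [Countable ι] (μ : Measure α) (Q : ι → Set α)
    (hQ : ∀ i, MeasurableSet (Q i)) (F : α → ℝ≥0∞) : Measurable (mmax μ Q F) :=
  Measurable.iSup fun i => measurable_const.indicator (hQ i)

lemma weak [Countable ι] (μ : Measure α) (Q : ι → Set α) (hQ : ∀ i, MeasurableSet (Q i))
    (hn : nested Q) (F : α → ℝ≥0∞) (l : ℝ≥0∞) :
    l * μ {x | l < mmax μ Q F x} ≤ ∫⁻ x, F x ∂μ := by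
  classical
  let s : Finset {i // l < mavg μ (Q i) F} → Set α := fun D => ⋃ i ∈ D, Q i.1
  have e : {x | l < mmax μ Q F x} ⊆ ⋃ D, s D := by
    intro x hx
    simp only [mmax, Set.mem_ofPred_eq, lt_iSup_iff] at hx
    obtain ⟨i, hi⟩ := hx
    by_cases hxi : x ∈ Q i
    · rw [Set.indicator_of_mem hxi] at hi
      simp only [s, Set.mem_iUnion]
      exact ⟨{⟨i, hi⟩}, ⟨i, hi⟩, by simp, hxi⟩
    · rw [Set.indicator_of_notMem hxi] at hi
      simp at hi
  have hdir : Directed (fun x1 x2 => x1 ⊆ x2) s := by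
    intro A B
    refine ⟨A ∪ B, ?_, ?_⟩ <;>
    · intro x hx
      simp only [s, Set.mem_iUnion, Finset.mem_union] at hx ⊢
      obtain ⟨k, hk, hx⟩ := hx
      exact ⟨k, by tauto, hx⟩
  calc l * μ {x | l < mmax μ Q F x} ≤ l * μ (⋃ D, s D) := by gcongr
    _ = ⨆ D, l * μ (s D) := by rw [hdir.measure_iUnion, ENNReal.mul_iSup]
    _ ≤ ∫⁻ x, F x ∂μ := by
      apply iSup_le
      intro D
      refine le_trans (fin_weak μ (fun i : {i // l < mavg μ (Q i) F} => Q i.1) (fun i => hQ _)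
        (fun i j => hn _ _) F l _ D le_rfl ?_) (setLIntegral_le_lintegral _ _)
      intro i _
      exact ENNReal.mul_le_of_le_div i.2.le

lemma weak2 [Countable ι] (μ : Measure α) (Q : ι → Set α) (hQ : ∀ i, MeasurableSet (Q i))
    (hn : nested Q) (F : α → ℝ≥0∞) (hF : Measurable F) (l : ℝ≥0∞) (hl : l ≠ ∞) :
    l * μ {x | 2 * l < mmax μ Q F x} ≤ ∫⁻ x in {x | l < F x}, F x ∂μ := by
  have hm : MeasurableSet {x | l < F x} := measurableSet_lt measurable_const hF
  rw [← lintegral_indicator hm]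
  refine le_trans ?_ (weak μ Q hQ hn _ l)
  gcongr l * μ ?_
  intro x hx
  simp only [mmax, Set.mem_ofPred_eq, lt_iSup_iff] at hx ⊢
  obtain ⟨i, hi⟩ := hx
  refine ⟨i, ?_⟩
  by_cases hxi : x ∈ Q i
  · rw [Set.indicator_of_mem hxi] at hi ⊢
    have h1 : mavg μ (Q i) F ≤ mavg μ (Q i) ({x | l < F x}.indicator fun x => F x) + l := by
      unfold mavg
      calc (∫⁻ x in Q i, F x ∂μ) / μ (Q i)
          ≤ (∫⁻ x in Q i, ({x | l < F x}.indicator (fun x => F x) x + l) ∂μ) / μ (Q i) := by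
            gcongr with x
            by_cases h : l < F x
            · rw [Set.indicator_of_mem (by exact h)]; exact le_self_add
            · rw [Set.indicator_of_notMem (by exact h)]; simpa using h
        _ = (∫⁻ x in Q i, ({x | l < F x}.indicator (fun x => F x) x) ∂μ) / μ (Q i)
              + l * μ (Q i) / μ (Q i) := by
            rw [lintegral_add_right _ measurable_const, ENNReal.add_div]; simp
        _ ≤ _ := by
            gcongr
            exact ENNReal.div_le_of_le_mul le_rfl
    have h2 : l + l < mavg μ (Q i) ({x | l < F x}.indicator fun x => F x) + l := by
      rw [← two_mul]; exact hi.trans_le h1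
    exact (ENNReal.add_lt_add_iff_right hl).1 h2
  · rw [Set.indicator_of_notMem hxi] at hi
    simp at hi

lemma layer (y : ℝ≥0∞) (a : ℝ) (ha : 0 < a) :
    ENNReal.ofReal a * ∫⁻ t in Set.Ioi (0:ℝ),
      {t : ℝ | ENNReal.ofReal t < y}.indicator (fun t => ENNReal.ofReal (t ^ (a - 1))) t = y ^ a := by
  have fin : ∀ z : ℝ, 0 ≤ z → ENNReal.ofReal a * ∫⁻ t in Set.Ioi (0:ℝ),
      {t : ℝ | ENNReal.ofReal t < ENNReal.ofReal z}.indicator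
        (fun t => ENNReal.ofReal (t ^ (a - 1))) t = (ENNReal.ofReal z) ^ a := by
    intro z hz
    have := lintegral_rpow_eq_lintegral_meas_lt_mul (Measure.dirac ()) (f := fun _ => z)
      (by filter_upwards; intro _; exact hz) aemeasurable_const ha
    simp only [lintegral_const, measure_univ, mul_one] at this
    rw [ENNReal.ofReal_rpow_of_nonneg hz ha.le, this]
    congr 1
    apply setLIntegral_congr_fun measurableSet_Ioi
    intro t ht
    have ht : 0 < t := ht
    by_cases h : t < z
    · have h' : ENNReal.ofReal t < ENNReal.ofReal z := (ENNReal.ofReal_lt_ofReal_iff (ht.trans h)).2 h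
      simp [Set.indicator, h, h']
    · have h' : ¬ ENNReal.ofReal t < ENNReal.ofReal z := by
        push Not at h ⊢
        exact ENNReal.ofReal_le_ofReal h
      simp [Set.indicator, h, h']
  by_cases hy : y = ∞
  · subst hy
    rw [ENNReal.top_rpow_of_pos ha, eq_top_iff]
    apply ENNReal.le_of_forall_nnreal_lt
    intro c _
    have h1 := fin ((c:ℝ) ^ (1/a)) (by positivity)
    rw [ENNReal.ofReal_rpow_of_nonneg (by positivity) ha.le, ← Real.rpow_mul (by positivity),
      one_div_mul_cancel ha.ne', Real.rpow_one, ENNReal.ofReal_coe_nnreal] at h1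
    rw [← h1]
    gcongr
    exact le_top
  · have := fin y.toReal ENNReal.toReal_nonneg
    rwa [ENNReal.ofReal_toReal hy] at this

lemma strong [Countable ι] (μ : Measure α) [SFinite μ] (Q : ι → Set α)
    (hQ : ∀ i, MeasurableSet (Q i))
    (hn : nested Q) (F : α → ℝ≥0∞) (hF : Measurable F) (p : ℝ) (hp : 1 < p) :
    ∫⁻ x, mmax μ Q F x ^ p ∂μ ≤
      ENNReal.ofReal (p * 2 ^ p / (p - 1)) * ∫⁻ x, F x ^ p ∂μ := by
  have hp0 : 0 < p := by linarith
  have hM := measurable_mmax μ Q hQ F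
  have hmeas : ∀ (G : α → ℝ≥0∞) (a : ℝ), Measurable G → Measurable (fun z : α × ℝ =>
      {t : ℝ | ENNReal.ofReal t < G z.1}.indicator (fun t => ENNReal.ofReal (t ^ a)) z.2) := by
    intro G a hG
    have : (fun z : α × ℝ =>
      {t : ℝ | ENNReal.ofReal t < G z.1}.indicator (fun t => ENNReal.ofReal (t ^ a)) z.2) =
      {z : α × ℝ | ENNReal.ofReal z.2 < G z.1}.indicator (fun z => ENNReal.ofReal (z.2 ^ a)) := by
      ext z; simp [Set.indicator]
    rw [this]
    apply Measurable.indicator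
    · fun_prop
    · apply measurableSet_lt <;> fun_prop
  calc ∫⁻ x, mmax μ Q F x ^ p ∂μ
      = ENNReal.ofReal p * ∫⁻ x, (∫⁻ t in Set.Ioi (0:ℝ),
          {t : ℝ | ENNReal.ofReal t < mmax μ Q F x}.indicator
            (fun t => ENNReal.ofReal (t ^ (p - 1))) t) ∂μ := by
        rw [← lintegral_const_mul']
        · simp_rw [layer _ p hp0]
        · simp
    _ = ENNReal.ofReal p * ∫⁻ t in Set.Ioi (0:ℝ), ENNReal.ofReal (t ^ (p - 1)) *
          μ {x | ENNReal.ofReal t < mmax μ Q F x} := by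
        rw [lintegral_lintegral_swap (hmeas _ _ hM).aemeasurable]
        congr 1
        apply lintegral_congr
        intro t
        rw [← setLIntegral_const, ← lintegral_indicator (measurableSet_lt measurable_const hM)]
        apply lintegral_congr
        intro x
        simp [Set.indicator]
    _ ≤ ENNReal.ofReal p * ∫⁻ t in Set.Ioi (0:ℝ), ENNReal.ofReal (2 * t ^ (p - 2)) *
          ∫⁻ x in {x | ENNReal.ofReal t < 2 * F x}, F x ∂μ := by
        gcongr _ * ?_
        apply setLIntegral_mono' measurableSet_Ioi
        intro t ht
        have ht : 0 < t := ht
        have := weak2 μ Q hQ hn F hF (ENNReal.ofReal (t/2)) (by simp)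
        have e1 : 2 * ENNReal.ofReal (t/2) = ENNReal.ofReal t := by
          rw [← ENNReal.ofReal_ofNat, ← ENNReal.ofReal_mul (by norm_num)]; congr 1; ring
        have e2 : {x | ENNReal.ofReal (t/2) < F x} = {x | ENNReal.ofReal t < 2 * F x} := by
          ext x
          simp only [Set.mem_ofPred_eq]
          rw [← e1, ENNReal.mul_lt_mul_iff_right (by simp) (by simp)]
        rw [e1, e2] at this
        refine le_trans ?_ (mul_le_mul_right this _)
        rw [← mul_assoc, ← ENNReal.ofReal_mul (by positivity)]
        apply le_of_eq
        congr 2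
        have : t ^ (p - 1) = t ^ (p - 2) * t := by
          rw [← Real.rpow_add_one ht.ne']; congr 1; ring
        rw [this]; ring
    _ = ENNReal.ofReal p * ∫⁻ x, (2 * F x) * (∫⁻ t in Set.Ioi (0:ℝ), {t : ℝ | ENNReal.ofReal t < 2 * F x}.indicator
          (fun t => ENNReal.ofReal (t ^ (p - 1 - 1))) t) ∂μ := by
        congr 1
        have hm2 : Measurable (fun x => 2 * F x) := hF.const_mul 2
        have hcm : ∀ x, (2 * F x) * (∫⁻ t in Set.Ioi (0:ℝ),
            {t : ℝ | ENNReal.ofReal t < 2 * F x}.indicator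
              (fun t => ENNReal.ofReal (t ^ (p - 1 - 1))) t) = ∫⁻ t in Set.Ioi (0:ℝ), (2 * F x) *
            {t : ℝ | ENNReal.ofReal t < 2 * F x}.indicator
              (fun t => ENNReal.ofReal (t ^ (p - 1 - 1))) t := by
          intro x
          rw [lintegral_const_mul]
          exact (hmeas _ (p - 1 - 1) hm2).comp (measurable_prodMk_left (x := x))
        simp_rw [hcm]
        rw [lintegral_lintegral_swap]
        · apply setLIntegral_congr_fun measurableSet_Ioi
          intro t ht
          have ht : 0 < t := ht
          have hms : MeasurableSet {x | ENNReal.ofReal t < 2 * F x} :=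
            measurableSet_lt measurable_const hm2
          simp only
          rw [← lintegral_indicator hms, ← lintegral_const_mul _ (hF.indicator hms)]
          apply lintegral_congr
          intro x
          have e3 : p - 1 - 1 = p - 2 := by ring
          rw [e3, ENNReal.ofReal_mul (by norm_num)]
          simp only [Set.indicator, Set.mem_ofPred_eq]
          split_ifs
          · simp; ring
          · simp
        · apply Measurable.aemeasurable
          exact (hm2.comp measurable_fst).mul (hmeas _ (p - 1 - 1) hm2)
    _ = _ := by
        have hp1 : 0 < p - 1 := by linarith
        have key : ∀ x, ENNReal.ofReal (p - 1) * ((2 * F x) * (∫⁻ t in Set.Ioi (0:ℝ), {t : ℝ | ENNReal.ofReal t < 2 * F x}.indicator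
          (fun t => ENNReal.ofReal (t ^ (p - 1 - 1))) t)) = ENNReal.ofReal (2 ^ p) * F x ^ p := by
          intro x
          rw [mul_left_comm, layer _ (p-1) hp1]
          have : (2 * F x) * (2 * F x) ^ (p - 1) = (2 * F x) ^ p := by
            conv_lhs => rw [← ENNReal.rpow_one (2 * F x), ← ENNReal.rpow_mul, one_mul]
            rw [← ENNReal.rpow_add_of_nonneg _ _ (by norm_num) hp1.le]
            congr 1; ring
          rw [this, ENNReal.mul_rpow_of_nonneg _ _ hp0.le, ← ENNReal.ofReal_rpow_of_pos (by norm_num)]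
          simp
        have h0 : ENNReal.ofReal (p - 1) ≠ 0 := by simpa using hp1
        have ht : ENNReal.ofReal (p - 1) ≠ ∞ := by simp
        rw [← ENNReal.mul_right_inj h0 ht, mul_left_comm, ← lintegral_const_mul' _ _ ht]
        simp_rw [key]
        rw [lintegral_const_mul' _ _ (by simp), ← mul_assoc, ← mul_assoc,
          ← ENNReal.ofReal_mul hp0.le, ← ENNReal.ofReal_mul hp1.le]
        congr 2
        field_simp

end Maximal
end Extrap

namespace Extrap

/-! ### Shifted dyadic grids -/

def goff (b : Bool) (k : ℤ) : ℝ := if b then (-1 : ℝ) ^ k / 3 else 0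

def gfl (b : Bool) (k : ℤ) (x : ℝ) : ℤ := ⌊(2:ℝ) ^ k * x - goff b k⌋

def gset {d : ℕ} (α : Fin d → Bool) (c : ℤ × (Fin d → ℤ)) : Set (Fin d → ℝ) :=
  {x | ∀ i, gfl (α i) c.1 (x i) = c.2 i}

def gcube {d : ℕ} (α : Fin d → Bool) (c : ℤ × (Fin d → ℤ)) : Cube d where
  corner := fun i => (2:ℝ) ^ (-c.1) * (c.2 i + goff (α i) c.1)
  side := (2:ℝ) ^ (-c.1)
  side_pos := by positivity

lemma gcube_set {d : ℕ} (α : Fin d → Bool) (c : ℤ × (Fin d → ℤ)) :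
    (gcube α c).set = gset α c := by
  ext x
  simp only [Cube.set, gset, gcube, Set.mem_ofPred_eq, gfl, Int.floor_eq_iff]
  apply forall_congr'
  intro i
  have h2 : (0:ℝ) < 2 ^ c.1 := by positivity
  rw [zpow_neg]
  constructor
  · rintro ⟨h, h'⟩
    constructor
    · rw [inv_mul_le_iff₀ h2] at h; linarith
    · rw [← mul_add_one, ← div_eq_inv_mul, lt_div_iff₀ h2] at h'; linarith
  · rintro ⟨h, h'⟩
    constructor
    · rw [inv_mul_le_iff₀ h2]; linarith
    · rw [← mul_add_one, ← div_eq_inv_mul, lt_div_iff₀ h2]; linarith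

lemma goff_succ (b : Bool) (k : ℤ) : ∃ e : ℤ, goff b (k + 1) - 2 * goff b k = e := by
  unfold goff
  cases b
  · exact ⟨0, by simp⟩
  · rcases Int.even_or_odd k with h | h
    · refine ⟨-1, ?_⟩
      have h' : Odd (k+1) := h.add_one
      simp [h.neg_one_zpow, h'.neg_one_zpow]; norm_num
    · refine ⟨1, ?_⟩
      have h' : Even (k+1) := h.add_one
      simp [h.neg_one_zpow, h'.neg_one_zpow]; norm_num

lemma gfl_succ (b : Bool) (k : ℤ) (x z : ℝ) (h : gfl b (k + 1) x = gfl b (k + 1) z) :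
    gfl b k x = gfl b k z := by
  obtain ⟨e, he⟩ := goff_succ b k
  have key : ∀ x : ℝ, gfl b k x = (gfl b (k + 1) x + e) / 2 := by
    intro x
    unfold gfl
    have h1 : (2:ℝ) ^ k * x - goff b k = ((2:ℝ) ^ (k+1) * x - goff b (k+1) + e) / (2:ℕ) := by
      rw [← he, zpow_add_one₀ (by norm_num)]; push_cast; ring
    rw [h1, Int.floor_div_natCast, Int.floor_add_intCast]
    norm_num
  rw [key, key, h]

lemma gfl_mono (b : Bool) (k l : ℤ) (hkl : k ≤ l) (x z : ℝ) : gfl b l x = gfl b l z →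
    gfl b k x = gfl b k z := by
  induction l, hkl using Int.leInduction with
  | base => exact id
  | succ n hn ih => exact fun h => ih (gfl_succ b n x z h)

lemma gset_nested {d : ℕ} (α : Fin d → Bool) : nested (gset α) := by
  have main : ∀ c c' : ℤ × (Fin d → ℤ), c.1 ≤ c'.1 → gset α c' ⊆ gset α c ∨
      Disjoint (gset α c) (gset α c') := by
    intro c c' h
    by_cases hd : Disjoint (gset α c) (gset α c')
    · exact Or.inr hd
    · left
      rw [Set.not_disjoint_iff] at hd
      obtain ⟨x, hx, hx'⟩ := hd
      intro z hz i
      rw [← hx i]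
      apply gfl_mono _ _ _ h
      rw [hz i, hx' i]
  intro c c'
  rcases le_total c.1 c'.1 with h | h
  · rcases main c c' h with h | h <;> tauto
  · rcases main c' c h with h | h
    · tauto
    · exact Or.inr (Or.inr h.symm)

lemma cube_measurable {d : ℕ} (Q : Cube d) : MeasurableSet Q.set := by
  have : Q.set = Set.univ.pi fun i => Set.Ico (Q.corner i) (Q.corner i + Q.side) := by
    ext x; simp [Cube.set]
  rw [this]
  exact MeasurableSet.univ_pi fun i => measurableSet_Ico

lemma cube_vol {d : ℕ} (Q : Cube d) : Q.vol = ENNReal.ofReal (Q.side) ^ d := by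
  have : Q.set = Set.univ.pi fun i => Set.Ico (Q.corner i) (Q.corner i + Q.side) := by
    ext x; simp [Cube.set]
  rw [Cube.vol, this, Real.volume_pi_Ico]
  simp

lemma gset_measurable {d : ℕ} (α : Fin d → Bool) (c : ℤ × (Fin d → ℤ)) :
    MeasurableSet (gset α c) := by
  rw [← gcube_set]; exact cube_measurable _

lemma one_third (k : ℤ) (c l : ℝ) (hk : (2:ℝ) ^ k * l ≤ 1 / 3) :
    ∃ b : Bool, ∀ x, c ≤ x → x < c + l → gfl b k x = gfl b k c := by
  have h2 : (0:ℝ) < 2 ^ k := by positivity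
  have main : ∀ b : Bool, Int.fract ((2:ℝ) ^ k * c - goff b k) ≤ 2 / 3 →
      ∀ x, c ≤ x → x < c + l → gfl b k x = gfl b k c := by
    intro b hb x hx hx'
    unfold gfl
    rw [Int.floor_eq_iff]
    have h3 := Int.floor_add_fract ((2:ℝ) ^ k * c - goff b k)
    have h4 := Int.fract_nonneg ((2:ℝ) ^ k * c - goff b k)
    have h5 : (2:ℝ) ^ k * c ≤ 2 ^ k * x := by gcongr
    have h6 : (2:ℝ) ^ k * x < 2 ^ k * c + 2 ^ k * l := by rw [← mul_add]; gcongr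
    constructor <;> linarith
  by_cases h : Int.fract ((2:ℝ) ^ k * c - goff false k) ≤ 2 / 3
  · exact ⟨false, main _ h⟩
  · refine ⟨true, main _ ?_⟩
    push Not at h
    simp only [goff, Bool.false_eq_true, if_false, if_true, sub_zero] at h ⊢
    set u := (2:ℝ) ^ k * c
    have h3 := Int.floor_add_fract u
    have h4 := Int.fract_lt_one u
    rcases Int.even_or_odd k with hk | hk
    · rw [hk.neg_one_zpow]
      have : Int.fract (u - 1/3) = Int.fract u - 1/3 := by
        rw [Int.fract_eq_iff]
        refine ⟨by linarith, by linarith, ⌊u⌋, by linarith⟩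
      rw [this]; linarith
    · rw [hk.neg_one_zpow]
      have : Int.fract (u - -1/3) = Int.fract u + 1/3 - 1 := by
        rw [Int.fract_eq_iff]
        refine ⟨by linarith, by linarith, ⌊u⌋ + 1, by push_cast; linarith⟩
      rw [this]; linarith

lemma cover {d : ℕ} (Q : Cube d) : ∃ α c, Q.set ⊆ gset (d := d) α c ∧
    (gcube α c).vol ≤ 6 ^ d * Q.vol := by
  have h3 : 0 < 3 * Q.side := by have := Q.side_pos; positivity
  obtain ⟨n, hn, hn'⟩ := exists_mem_Ioc_zpow h3 (one_lt_two (α := ℝ))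
  -- 2^n < 3 l ≤ 2^(n+1)
  have hk : (2:ℝ) ^ (-(n+1)) * Q.side ≤ 1/3 := by
    rw [zpow_neg, inv_mul_le_iff₀ (by positivity)]; linarith
  choose α hα using fun i => one_third (-(n+1)) (Q.corner i) Q.side hk
  refine ⟨α, (-(n+1), fun i => gfl (α i) (-(n+1)) (Q.corner i)), ?_, ?_⟩
  · intro x hx i
    exact hα i (x i) (hx i).1 (hx i).2
  · rw [cube_vol, cube_vol, ← mul_pow]
    gcongr
    simp only [gcube]
    rw [← ENNReal.ofReal_ofNat, ← ENNReal.ofReal_mul (by norm_num)]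
    apply ENNReal.ofReal_le_ofReal
    rw [neg_neg, zpow_add_one₀ (by norm_num)]
    linarith

/-! ### The Rubio de Francia iteration -/

section RdF
variable {E : Type*} [MeasurableSpace E] {I : Type*}

/-- one piece of the operator -/
def piece (μ : Measure E) (σ : E → ℝ≥0∞) (θ : ℝ) (Q : Set E) (H : E → ℝ≥0∞) : ℝ≥0∞ :=
  ((∫⁻ x in Q, σ x ^ (1 - θ) * H x ^ θ ∂μ) / (∫⁻ x in Q, σ x ∂μ)) ^ (1 / θ)

def Nop (μ : Measure E) (σ : E → ℝ≥0∞) (θ : ℝ) (Q : I → Set E) (H : E → ℝ≥0∞) (x : E) : ℝ≥0∞ :=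
  ⨆ i, (Q i).indicator (fun x => piece μ σ θ (Q i) H * σ x) x

lemma Nop_measurable [Countable I] (μ : Measure E) (σ : E → ℝ≥0∞) (hσ : Measurable σ) (θ : ℝ)
    (Q : I → Set E) (hQ : ∀ i, MeasurableSet (Q i)) (H : E → ℝ≥0∞) :
    Measurable (Nop μ σ θ Q H) :=
  Measurable.iSup fun i => (hσ.const_mul _).indicator (hQ i)

lemma piece_mono (μ : Measure E) (σ : E → ℝ≥0∞) (θ : ℝ) (hθ : 0 < θ) (Q : Set E)
    {H H' : E → ℝ≥0∞} (h : H ≤ H') : piece μ σ θ Q H ≤ piece μ σ θ Q H' := by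
  unfold piece
  gcongr with x
  exact h x

lemma Nop_mono (μ : Measure E) (σ : E → ℝ≥0∞) (θ : ℝ) (hθ : 0 < θ) (Q : I → Set E)
    {H H' : E → ℝ≥0∞} (h : H ≤ H') : Nop μ σ θ Q H ≤ Nop μ σ θ Q H' := by
  intro x
  apply iSup_mono
  intro i
  apply Set.indicator_le_indicator
  gcongr
  exact piece_mono μ σ θ hθ _ h

lemma Nop_bound [Countable I] (μ : Measure E) [SFinite μ] (σ : E → ℝ≥0∞) (hσ : Measurable σ)
    (h0 : ∀ x, σ x ≠ 0) (ht : ∀ x, σ x ≠ ∞) (θ : ℝ) (hθ : 0 < θ) (hθ1 : θ < 1)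
    (Q : I → Set E) (hQ : ∀ i, MeasurableSet (Q i)) (hn : nested Q) (H : E → ℝ≥0∞)
    (hH : Measurable H) :
    ∫⁻ x, Nop μ σ θ Q H x ∂μ ≤
      ENNReal.ofReal ((1/θ) * 2 ^ (1/θ) / (1/θ - 1)) * ∫⁻ x, H x ∂μ := by
  set ν := μ.withDensity σ with hν
  have hF : Measurable (fun x => (H x / σ x) ^ θ) := by fun_prop
  have hp : 1 < 1 / θ := by rw [lt_div_iff₀ hθ]; linarith
  have key := strong ν Q hQ hn (fun x => (H x / σ x) ^ θ) hF (1/θ) hp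
  have e1 : ∫⁻ x, ((H x / σ x) ^ θ) ^ (1/θ) ∂ν = ∫⁻ x, H x ∂μ := by
    rw [hν, lintegral_withDensity_eq_lintegral_mul _ hσ (by fun_prop)]
    apply lintegral_congr
    intro x
    simp only [Pi.mul_apply]
    rw [← ENNReal.rpow_mul, mul_one_div_cancel hθ.ne', ENNReal.rpow_one,
      ENNReal.mul_div_cancel (h0 x) (ht x)]
  have e2 : ∫⁻ x, Nop μ σ θ Q H x ∂μ = ∫⁻ x, mmax ν Q (fun x => (H x / σ x) ^ θ) x ^ (1/θ) ∂ν := by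
    rw [hν, lintegral_withDensity_eq_lintegral_mul _ hσ
      ((measurable_mmax _ Q hQ _).pow_const _), ← hν]
    apply lintegral_congr
    intro x
    simp only [Pi.mul_apply, Nop, mmax]
    have := (ENNReal.orderIsoRpow (1/θ) (by positivity)).map_iSup
      (fun i => (Q i).indicator (fun _ => mavg ν (Q i) (fun x => (H x / σ x) ^ θ)) x)
    simp only [ENNReal.orderIsoRpow_apply] at this
    rw [this, ENNReal.mul_iSup]
    congr 1
    ext i
    by_cases hx : x ∈ Q i
    · rw [Set.indicator_of_mem hx, Set.indicator_of_mem hx, mul_comm]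
      congr 1
      unfold piece mavg
      congr 2
      · rw [hν, setLIntegral_withDensity_eq_setLIntegral_mul _ hσ hF (hQ i)]
        apply lintegral_congr
        intro x
        simp only [Pi.mul_apply]
        rw [ENNReal.div_rpow_of_nonneg _ _ hθ.le, div_eq_mul_inv, ← ENNReal.rpow_neg,
          ENNReal.rpow_sub _ _ (h0 x) (ht x), ENNReal.rpow_one, ENNReal.rpow_neg, div_eq_mul_inv]
        ring
      · rw [hν, withDensity_apply _ (hQ i)]
    · rw [Set.indicator_of_notMem hx, Set.indicator_of_notMem hx]
      rw [ENNReal.zero_rpow_of_pos (by positivity), mul_zero]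
  rw [e2, ← e1]
  exact key

lemma piece_iSup (μ : Measure E) (σ : E → ℝ≥0∞) (hσ : Measurable σ) (θ : ℝ) (hθ : 0 < θ)
    (Q : Set E) (ψ : ℕ → E → ℝ≥0∞) (hm : ∀ n, Measurable (ψ n)) (hmono : Monotone ψ) :
    piece μ σ θ Q (fun x => ⨆ n, ψ n x) = ⨆ n, piece μ σ θ Q (ψ n) := by
  unfold piece
  have h1 := (ENNReal.orderIsoRpow (1/θ) (by positivity)).map_iSup
      (fun n => (∫⁻ x in Q, σ x ^ (1 - θ) * ψ n x ^ θ ∂μ) / (∫⁻ x in Q, σ x ∂μ))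
  simp only [ENNReal.orderIsoRpow_apply] at h1
  rw [← h1, ← ENNReal.iSup_div, ← lintegral_iSup]
  · congr 2
    apply lintegral_congr
    intro x
    have h2 := (ENNReal.orderIsoRpow θ hθ).map_iSup (fun n => ψ n x)
    simp only [ENNReal.orderIsoRpow_apply] at h2
    rw [h2, ENNReal.mul_iSup]
  · intro n; have := hm n; fun_prop
  · intro n n' h x
    have := hmono h x
    simp only
    gcongr

/-- abstract iteration -/
lemma iterate (μ : Measure E) (U : (E → ℝ≥0∞) → E → ℝ≥0∞) (K : ℝ≥0∞) (hK0 : K ≠ 0) (hK : K ≠ ∞)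
    (hUmono : ∀ H H', H ≤ H' → U H ≤ U H') (hUm : ∀ H, Measurable (U H))
    (hUb : ∀ H, Measurable H → ∫⁻ x, U H x ∂μ ≤ K * ∫⁻ x, H x ∂μ)
    (h : E → ℝ≥0∞) (hh : Measurable h) :
    ∃ ψ : ℕ → E → ℝ≥0∞, Monotone ψ ∧ (∀ n, Measurable (ψ n)) ∧ (∀ n, h ≤ ψ n) ∧
      (∀ n, ∫⁻ x, ψ n x ∂μ ≤ 3 / 2 * ∫⁻ x, h x ∂μ) ∧
      ∀ n x, U (ψ n) x ≤ (3 * K) * ψ (n + 1) x := by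
  let ψ : ℕ → E → ℝ≥0∞ := fun n => Nat.rec h (fun _ g x => h x + (3 * K)⁻¹ * U g x) n
  have hs : ∀ n x, ψ (n+1) x = h x + (3 * K)⁻¹ * U (ψ n) x := fun n x => rfl
  have hmeas : ∀ n, Measurable (ψ n) := by
    intro n
    cases n with
    | zero => exact hh
    | succ n => exact hh.add ((hUm _).const_mul _)
  have hstep : ∀ n, ψ n ≤ ψ (n+1) := by
    intro n
    induction n with
    | zero => intro x; rw [hs]; exact le_self_add
    | succ n ih =>
      intro x
      rw [hs, hs (n+1)]
      gcongr
      exact hUmono _ _ ih x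
  have hKthree : 3 * K ≠ 0 := by simp [hK0]
  have hKthree' : 3 * K ≠ ∞ := ENNReal.mul_ne_top (by simp) hK
  refine ⟨ψ, monotone_nat_of_le_succ hstep, hmeas, ?_, ?_, ?_⟩
  · intro n
    cases n with
    | zero => exact le_rfl
    | succ n => intro x; rw [hs]; exact le_self_add
  · have e32 : (1:ℝ≥0∞) + 3⁻¹ * (3 / 2) = 3 / 2 := by
      have : (3:ℝ≥0∞)⁻¹ * (3/2) = 1/2 := by
        rw [div_eq_mul_inv, ← mul_assoc, ENNReal.inv_mul_cancel (by simp) (by simp), one_mul, one_div]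
      rw [this]
      rw [← ENNReal.toReal_eq_toReal_iff' (by finiteness) (by finiteness),
        ENNReal.toReal_add (by finiteness) (by finiteness)]
      norm_num
    intro n
    induction n with
    | zero =>
      calc ∫⁻ x, ψ 0 x ∂μ = 1 * ∫⁻ x, h x ∂μ := by rw [one_mul]; rfl
        _ ≤ _ := by
          gcongr
          rw [← e32]; exact le_self_add
    | succ n ih =>
      simp_rw [hs]
      rw [lintegral_add_left hh, lintegral_const_mul _ (hUm _)]
      calc ∫⁻ x, h x ∂μ + (3 * K)⁻¹ * ∫⁻ x, U (ψ n) x ∂μ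
          ≤ ∫⁻ x, h x ∂μ + (3 * K)⁻¹ * (K * (3/2 * ∫⁻ x, h x ∂μ)) := by
            gcongr
            refine (hUb _ (hmeas n)).trans ?_
            gcongr
        _ = (1 + 3⁻¹ * (3/2) ) * ∫⁻ x, h x ∂μ := by
            have : (3 * K)⁻¹ * K = 3⁻¹ := by
              rw [ENNReal.mul_inv (by simp) (by simp), mul_assoc, ENNReal.inv_mul_cancel hK0 hK, mul_one]
            rw [← mul_assoc, this]; ring
        _ = _ := by rw [e32]
  · intro n x
    rw [hs, mul_add, ← mul_assoc, ENNReal.mul_inv_cancel hKthree hKthree', one_mul]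
    exact le_add_self

end RdF

/-- The Rubio de Francia majorant adapted to finitely many weights and all the shifted grids. -/
lemma rdf (d : ℕ) {I : Type*} [Fintype I] (θ : I → ℝ) (hθ : ∀ i, 0 < θ i) (hθ1 : ∀ i, θ i < 1) :
    ∃ K : ℝ≥0∞, K ≠ 0 ∧ K ≠ ∞ ∧ ∀ (σ : I → (Fin d → ℝ) → ℝ≥0∞), (∀ i, Measurable (σ i)) →
      (∀ i x, σ i x ≠ 0) → (∀ i x, σ i x ≠ ∞) → ∀ h : (Fin d → ℝ) → ℝ≥0∞, Measurable h →
      ∃ H : (Fin d → ℝ) → ℝ≥0∞, Measurable H ∧ h ≤ H ∧ ∫⁻ x, H x ≤ 3 / 2 * ∫⁻ x, h x ∧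
        ∀ i α c, ∀ x ∈ gset α c, piece volume (σ i) (θ i) (gset α c) H * σ i x ≤ K * H x := by
  let K : ℝ≥0∞ := 1 + ∑ α : Fin d → Bool, ∑ i : I,
    ENNReal.ofReal ((1/θ i) * 2 ^ (1/θ i) / (1/θ i - 1))
  have hK0 : K ≠ 0 := by simp [K]
  have hK : K ≠ ∞ := ENNReal.add_ne_top.2 ⟨by simp, ENNReal.sum_ne_top.2 fun _ _ =>
    ENNReal.sum_ne_top.2 fun _ _ => ofReal_ne_top⟩
  refine ⟨3 * K, by simp [hK0], ENNReal.mul_ne_top (by simp) hK, ?_⟩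
  intro σ hσ h0 ht h hh
  let U : ((Fin d → ℝ) → ℝ≥0∞) → (Fin d → ℝ) → ℝ≥0∞ := fun H x =>
    ∑ α : Fin d → Bool, ∑ i : I, Nop volume (σ i) (θ i) (gset α) H x
  have hNm : ∀ (α : Fin d → Bool) i H, Measurable (Nop volume (σ i) (θ i) (gset α) H) := fun α i H =>
    Nop_measurable _ _ (hσ i) _ _ (gset_measurable α) _
  obtain ⟨ψ, hmono, hm, hhψ, hIntg, hU⟩ := iterate volume U K hK0 hK
    (by
      intro H H' hHH x
      apply Finset.sum_le_sum; intro α _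
      apply Finset.sum_le_sum; intro i _
      exact Nop_mono _ _ _ (hθ i) _ hHH x)
    (by
      intro H
      apply Finset.measurable_sum; intro α _
      apply Finset.measurable_sum; intro i _
      exact hNm α i H)
    (by
      intro H hH
      simp only [U]
      rw [lintegral_finsetSum _ (fun α _ => Finset.measurable_sum _ (fun i _ => hNm α i H))]
      simp only [K]
      rw [add_mul, Finset.sum_mul]
      refine le_trans ?_ le_add_self
      apply Finset.sum_le_sum; intro α _
      rw [lintegral_finsetSum _ (fun i _ => hNm α i H), Finset.sum_mul]
      apply Finset.sum_le_sum; intro i _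
      exact Nop_bound _ _ (hσ i) (h0 i) (ht i) _ (hθ i) (hθ1 i) _ (gset_measurable α)
        (gset_nested α) H hH)
    h hh
  refine ⟨fun x => ⨆ n, ψ n x, Measurable.iSup hm, fun x => (hhψ 0 x).trans (le_iSup (fun n => ψ n x) 0),
    ?_, ?_⟩
  · rw [lintegral_iSup hm hmono]
    exact iSup_le hIntg
  · intro i α c x hx
    rw [piece_iSup _ _ (hσ i) _ (hθ i) _ _ hm hmono, ENNReal.iSup_mul]
    apply iSup_le
    intro n
    calc piece volume (σ i) (θ i) (gset α c) (ψ n) * σ i x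
        ≤ Nop volume (σ i) (θ i) (gset α) (ψ n) x := by
          unfold Nop
          refine le_trans (le_of_eq ?_) (le_iSup _ c)
          rw [Set.indicator_of_mem hx]
      _ ≤ U (ψ n) x := by
          refine le_trans ?_ (Finset.single_le_sum (f := fun α => ∑ i : I, Nop volume (σ i) (θ i) (gset α) (ψ n) x)
            (fun _ _ => zero_le) (Finset.mem_univ α))
          exact Finset.single_le_sum (f := fun i => Nop volume (σ i) (θ i) (gset α) (ψ n) x)
            (fun _ _ => zero_le) (Finset.mem_univ i)
      _ ≤ 3 * K * ψ (n+1) x := hU n x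
      _ ≤ _ := by gcongr; exact le_iSup (fun n => ψ n x) (n+1)

end Extrap

namespace Extrap

/-! ### Exponentials and the estimate on a single cube -/

def EE (x : ℝ) : ℝ≥0∞ := ENNReal.ofReal (Real.exp x)

lemma EE_ne_zero (x : ℝ) : EE x ≠ 0 := by simp [EE, Real.exp_pos]
lemma EE_ne_top (x : ℝ) : EE x ≠ ∞ := by simp [EE]
lemma EE_add (x y : ℝ) : EE (x + y) = EE x * EE y := by
  simp [EE, Real.exp_add, ENNReal.ofReal_mul (Real.exp_pos x).le]
lemma EE_zero : EE 0 = 1 := by simp [EE]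
lemma EE_rpow (x c : ℝ) : EE x ^ c = EE (c * x) := by
  rw [EE, ENNReal.ofReal_rpow_of_pos (Real.exp_pos x), ← Real.exp_mul, mul_comm, EE]
lemma EE_le {x y : ℝ} : EE x ≤ EE y ↔ x ≤ y := by
  rw [EE, EE, ENNReal.ofReal_le_ofReal_iff (Real.exp_pos _).le, Real.exp_le_exp]
lemma EE_mono {x y : ℝ} (h : x ≤ y) : EE x ≤ EE y := EE_le.2 h
lemma EE_inj {x y : ℝ} (h : EE x = EE y) : x = y :=
  le_antisymm (EE_le.1 h.le) (EE_le.1 h.ge)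
lemma EE_neg (x : ℝ) : EE (-x) = (EE x)⁻¹ := by
  rw [EE, Real.exp_neg, ENNReal.ofReal_inv_of_pos (Real.exp_pos x), EE]
lemma EE_sub (x y : ℝ) : EE (x - y) = EE x / EE y := by
  rw [sub_eq_add_neg, EE_add, EE_neg, div_eq_mul_inv]
lemma EE_sum {I : Type*} (s : Finset I) (f : I → ℝ) : EE (∑ i ∈ s, f i) = ∏ i ∈ s, EE (f i) := by
  simp only [EE, Real.exp_sum]
  rw [ENNReal.ofReal_prod_of_nonneg fun i _ => (Real.exp_pos _).le]
lemma EE_log {x : ℝ≥0∞} (h0 : x ≠ 0) (ht : x ≠ ∞) : EE (Real.log x.toReal) = x := by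
  rw [EE, Real.exp_log (ENNReal.toReal_pos h0 ht), ENNReal.ofReal_toReal ht]
lemma EE_exists {x : ℝ≥0∞} (h0 : x ≠ 0) (ht : x ≠ ∞) : ∃ y, x = EE y := ⟨_, (EE_log h0 ht).symm⟩
lemma EE_meas {E : Type*} [MeasurableSpace E] {f : E → ℝ} (hf : Measurable f) :
    Measurable fun x => EE (f x) := by unfold EE; fun_prop

def LN {E : Type*} [MeasurableSpace E] (P : ℝ) (μ : Measure E) (F : E → ℝ≥0∞) : ℝ≥0∞ :=
  if P = 0 then essSup F μ else (∫⁻ x, F x ^ (1 / P) ∂μ) ^ P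

lemma LN_mono {E : Type*} [MeasurableSpace E] {P : ℝ} (hP : 0 ≤ P) {μ : Measure E} {F G : E → ℝ≥0∞}
    (h : ∀ᵐ x ∂μ, F x ≤ G x) : LN P μ F ≤ LN P μ G := by
  unfold LN
  split_ifs with h0
  · exact essSup_mono_ae h
  · refine ENNReal.rpow_le_rpow (lintegral_mono_ae ?_) hP
    filter_upwards [h] with x hx
    gcongr

lemma int_EE_ne_zero {E : Type*} [MeasurableSpace E] (ν : Measure E) [NeZero ν]
    {f : E → ℝ} (hf : Measurable f) : ∫⁻ x, EE (f x) ∂ν ≠ 0 := by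
  rw [Ne, lintegral_eq_zero_iff (EE_meas hf)]
  intro h
  have : ∀ᵐ x ∂ν, False := by
    filter_upwards [h] with x hx
    exact EE_ne_zero _ hx
  have h2 : ν = 0 := by simpa [ae_iff] using this
  exact NeZero.ne ν h2

lemma qlevel {E : Type*} [MeasurableSpace E] (ν : Measure E) [IsProbabilityMeasure ν]
    {I : Type*} [Fintype I] [DecidableEq I]
    (a b : I → ℝ) (ha : ∀ i, 0 < a i) (hb : ∀ i, 0 ≤ b i) (hab : ∑ i, a i = ∑ i, b i)
    (β : ℝ) (hβ : 0 < β) (hδ : ∀ i, b i - a i ≤ β * a i) (Δ : ℝ)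
    (hΔ : Δ = ∑ i, max (b i - a i) 0) (hΔ0 : 0 < Δ) (θ : I → ℝ)
    (hθ : ∀ i, θ i = if 0 < b i - a i then (b i - a i) / b i else Δ / (Δ + β * a i))
    (g : I → E → ℝ) (hg : ∀ i, Measurable (g i)) (hsum : ∀ x, ∑ i, a i * g i x = 0)
    (η : E → ℝ) (hη : Measurable η) (κ : ℝ)
    (hs : ∀ i, ∫⁻ x, EE (g i x) ∂ν ≠ ∞) (hH : ∫⁻ x, EE (η x) ∂ν ≠ ∞)
    (hc : ∀ i, ∀ᵐ x ∂ν, ((∫⁻ x, EE ((1 - θ i) * g i x + θ i * η x) ∂ν) /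
      ∫⁻ x, EE (g i x) ∂ν) ^ (1 / θ i) * EE (g i x) ≤ EE κ * EE (η x)) :
    ∏ i, LN (b i) ν (fun x => EE (a i * g i x + (b i - a i) * η x)) ≤
      EE (2 * Δ * κ) * (∏ i, (∫⁻ x, EE (g i x) ∂ν) ^ a i) ^ (1 + β) := by
  -- the exponents
  have hθ0 : ∀ i, 0 < θ i := by
    intro i
    rw [hθ]
    split_ifs with h
    · exact div_pos h (by linarith [ha i])
    · have := ha i; positivity
  have hθ1 : ∀ i, θ i < 1 := by
    intro i
    rw [hθ]
    split_ifs with h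
    · rw [div_lt_one (by linarith [ha i])]; linarith [ha i]
    · have : 0 < β * a i := mul_pos hβ (ha i)
      rw [div_lt_one (by linarith)]; linarith
  -- logarithms
  choose S hS using fun i => EE_exists (int_EE_ne_zero ν (hg i)) (hs i)
  have hem : ∀ i, Measurable fun x => (1 - θ i) * g i x + θ i * η x := by
    intro i; have := hg i; fun_prop
  have hefin : ∀ i, ∫⁻ x, EE ((1 - θ i) * g i x + θ i * η x) ∂ν ≠ ∞ := by
    intro i
    apply ne_top_of_le_ne_top (ENNReal.add_ne_top.2 ⟨hs i, hH⟩)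
    rw [← lintegral_add_left (EE_meas (hg i))]
    apply lintegral_mono
    intro x
    have h1 := hθ0 i
    have h2 := hθ1 i
    rcases le_total (g i x) (η x) with h | h
    · refine le_trans (EE_mono ?_) (le_add_self (a := EE (η x)))
      nlinarith
    · refine le_trans (EE_mono ?_) (le_self_add (a := EE (g i x)))
      nlinarith
  choose L hL using fun i => EE_exists (int_EE_ne_zero ν (hem i)) (hefin i)
  set Y : I → ℝ := fun i => (L i - S i) / θ i with hY
  have hc' : ∀ i, ∀ᵐ x ∂ν, Y i + g i x ≤ κ + η x := by
    intro i
    filter_upwards [hc i] with x hx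
    rw [hS, hL, ← EE_sub, EE_rpow, ← EE_add, ← EE_add, EE_le] at hx
    have : Y i = 1 / θ i * (L i - S i) := by simp only [hY]; ring
    linarith
  have hLY : ∀ i, L i = S i + θ i * Y i := by
    intro i
    have := (hθ0 i).ne'
    simp only [hY]; field_simp; ring
  -- each factor
  have hfac : ∀ i, LN (b i) ν (fun x => EE (a i * g i x + (b i - a i) * η x)) ≤
      EE (b i * S i + (b i - a i) * Y i + κ * max (-(b i - a i)) 0) := by
    intro i
    by_cases h : 0 < b i - a i
    · have hbi : 0 < b i := by linarith [ha i]
      have hθi : θ i = (b i - a i) / b i := by rw [hθ, if_pos h]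
      rw [LN, if_neg hbi.ne']
      have : ∀ x, EE (a i * g i x + (b i - a i) * η x) ^ (1 / b i) =
          EE ((1 - θ i) * g i x + θ i * η x) := by
        intro x
        rw [EE_rpow]
        congr 1
        rw [hθi]; field_simp; ring
      simp_rw [this]
      rw [hL, EE_rpow]
      apply EE_mono
      rw [hLY, max_eq_right (by linarith), hθi]
      apply le_of_eq
      field_simp; ring
    · rw [max_eq_left (by linarith)]
      have hbd : ∀ᵐ x ∂ν, EE (a i * g i x + (b i - a i) * η x) ≤
          EE (b i * g i x + (a i - b i) * (κ - Y i)) := by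
        filter_upwards [hc' i] with x hx
        apply EE_mono
        have : (a i - b i) * (Y i + g i x) ≤ (a i - b i) * (κ + η x) :=
          mul_le_mul_of_nonneg_left hx (by linarith)
        linarith
      refine (LN_mono (hb i) hbd).trans ?_
      rw [LN]
      split_ifs with hb0
      · refine essSup_le_of_ae_le _ ?_
        filter_upwards with x
        apply EE_mono
        rw [hb0]; apply le_of_eq; ring
      · have hbi : 0 < b i := lt_of_le_of_ne (hb i) (Ne.symm hb0)
        have : ∀ x, EE (b i * g i x + (a i - b i) * (κ - Y i)) ^ (1 / b i) =
          EE ((a i - b i) * (κ - Y i) / b i) * EE (g i x) := by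
          intro x
          rw [EE_rpow, ← EE_add]
          congr 1
          field_simp; ring
        simp_rw [this]
        rw [lintegral_const_mul _ (EE_meas (hg i)), hS, ← EE_add, EE_rpow]
        apply EE_mono
        apply le_of_eq
        field_simp; ring
  -- the geometric mean
  set δ : I → ℝ := fun i => max (b i - a i) 0 with hδdef
  have hδ0 : ∀ i, 0 ≤ δ i := fun i => le_max_right _ _
  have hδβ : ∀ i, δ i ≤ β * a i := fun i => max_le (hδ i) (mul_pos hβ (ha i)).le
  have hΔs : ∑ i, δ i = Δ := hΔ.symm
  set A := ∑ i, a i with hA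
  set Λ := ∑ i, a i * S i with hΛ
  have hlow : ∀ k, b k - a k < 0 →
      (∑ i, δ i * Y i) - Δ * κ - β * Λ + (∑ i, δ i * S i) - Δ * S k ≤ Δ * Y k := by
    intro k hk
    have hδk : δ k = 0 := max_eq_right hk.le
    set τ := θ k with hτ
    have hτe : τ = Δ / (Δ + β * a k) := by rw [hτ, hθ, if_neg (by linarith)]
    have hβa : 0 < β * a k := mul_pos hβ (ha k)
    have hden : 0 < Δ + β * a k := by linarith
    have hall : ∀ᵐ x ∂ν, ∀ i, Y i + g i x ≤ κ + η x := ae_all_iff.2 hc'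
    have hge : ∀ᵐ x ∂ν, (∑ i, δ i * Y i) + (∑ i, δ i * g i x) ≤ Δ * (κ + η x) := by
      filter_upwards [hall] with x hx
      rw [← Finset.sum_add_distrib, ← hΔs, Finset.sum_mul]
      apply Finset.sum_le_sum
      intro i _
      rw [← mul_add]
      exact mul_le_mul_of_nonneg_left (hx i) (hδ0 i)
    set gb : E → ℝ := fun x => (1 - τ) * g k x + τ / Δ * ∑ i, δ i * g i x with hgb
    have hgbm : Measurable gb := by
      have : ∀ i, Measurable fun x => δ i * g i x := fun i => (hg i).const_mul _
      have h2 := Finset.measurable_sum Finset.univ (fun i _ => this i)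
      have := hg k
      fun_prop
    have hle : EE (τ / Δ * ((∑ i, δ i * Y i) - Δ * κ)) * ∫⁻ x, EE (gb x) ∂ν ≤ EE (L k) := by
      rw [← lintegral_const_mul _ (EE_meas hgbm), ← hL k]
      apply lintegral_mono_ae
      filter_upwards [hge] with x hx
      rw [← EE_add]
      apply EE_mono
      have : τ / Δ * ((∑ i, δ i * Y i) + (∑ i, δ i * g i x)) ≤ τ / Δ * (Δ * (κ + η x)) :=
        mul_le_mul_of_nonneg_left hx (div_nonneg (hθ0 k).le hΔ0.le)
      have e : τ / Δ * (Δ * (κ + η x)) = τ * κ + τ * η x := by field_simp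
      have e2 : τ / Δ * (Δ * κ) = τ * κ := by field_simp
      simp only [hgb]
      linarith
    have hgbfin : ∫⁻ x, EE (gb x) ∂ν ≠ ∞ := by
      intro h
      rw [h, ENNReal.mul_top (EE_ne_zero _)] at hle
      exact EE_ne_top _ (top_le_iff.1 hle)
    obtain ⟨G, hG⟩ := EE_exists (int_EE_ne_zero ν hgbm) hgbfin
    rw [hG, ← EE_add, EE_le] at hle
    -- Hölder
    have hApos : 0 < β * A := mul_pos hβ (Finset.sum_pos (fun i _ => ha i) ⟨k, Finset.mem_univ k⟩)
    set e : I → ℝ := fun i => if i = k then Δ + β * a k else β * a i - δ i with he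
    set f : I → E → ℝ := fun i => if i = k then gb else g i with hf
    have split : ∀ F : I → ℝ, ∑ i, F i = F k + ∑ i ∈ Finset.univ.erase k, F i := fun F =>
      (Finset.add_sum_erase _ _ (Finset.mem_univ k)).symm
    have hesum : ∑ i, e i = β * A := by
      have h1 : ∑ i, e i = ∑ i, ((β * a i - δ i) + if i = k then Δ else 0) := by
        apply Finset.sum_congr rfl
        intro i _
        simp only [he]
        by_cases hik : i = k
        · subst hik; simp [hδk]; ring
        · simp [hik]
      rw [h1, Finset.sum_add_distrib, Finset.sum_sub_distrib, hΔs, ← Finset.mul_sum]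
      simp [hA]
    have hold := ENNReal.lintegral_prod_norm_pow_le (μ := ν) Finset.univ
      (f := fun i x => EE (f i x)) (p := fun i => e i / (β * A))
      (by
        intro i _
        apply (EE_meas _).aemeasurable
        simp only [hf]
        split_ifs
        · exact hgbm
        · exact hg i)
      (by rw [← Finset.sum_div, hesum, div_self hApos.ne'])
      (by
        intro i _
        apply div_nonneg _ hApos.le
        simp only [he]
        split_ifs
        · exact hden.le
        · linarith [hδβ i])
    have hone : ∀ x, ∏ i, EE (f i x) ^ (e i / (β * A)) = 1 := by
      intro x
      simp_rw [EE_rpow]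
      rw [← EE_sum, ← EE_zero]
      congr 1
      have h1 : ∑ i, e i * f i x = 0 := by
        rw [split]
        have h2 : ∑ i ∈ Finset.univ.erase k, e i * f i x =
            ∑ i ∈ Finset.univ.erase k, (β * (a i * g i x) - δ i * g i x) := by
          apply Finset.sum_congr rfl
          intro i hi
          have hik := Finset.ne_of_mem_erase hi
          simp only [he, hf, if_neg hik]; ring
        have h3 := split (fun i => β * (a i * g i x) - δ i * g i x)
        rw [Finset.sum_sub_distrib, ← Finset.mul_sum, hsum x] at h3
        rw [h2]
        have h4 : e k * f k x = β * a k * g k x + ∑ i, δ i * g i x := by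
          simp only [he, hf, if_true, hgb]
          rw [hτe]
          field_simp; ring
        rw [h4]
        simp only [hδk] at h3
        linarith
      calc ∑ i, e i / (β * A) * f i x = (∑ i, e i * f i x) / (β * A) := by
            rw [Finset.sum_div]; apply Finset.sum_congr rfl; intro i _; ring
        _ = 0 := by rw [h1]; simp
    simp_rw [hone] at hold
    have hprod : ∏ i, (∫⁻ x, EE (f i x) ∂ν) ^ (e i / (β * A)) =
        EE ((∑ i, e i * (if i = k then G else S i)) / (β * A)) := by
      rw [Finset.sum_div, EE_sum]
      apply Finset.prod_congr rfl
      intro i _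
      have : ∫⁻ x, EE (f i x) ∂ν = EE (if i = k then G else S i) := by
        simp only [hf]
        split_ifs
        · exact hG
        · exact hS i
      rw [this, EE_rpow]
      congr 1; ring
    rw [hprod, lintegral_const, measure_univ, mul_one, ← EE_zero, EE_le] at hold
    have hold2 : 0 ≤ ∑ i, e i * (if i = k then G else S i) := by
      by_contra hneg
      push Not at hneg
      have := div_neg_of_neg_of_pos hneg hApos
      linarith
    rw [split] at hold2
    have h2 : ∑ i ∈ Finset.univ.erase k, e i * (if i = k then G else S i) =
        ∑ i ∈ Finset.univ.erase k, (β * (a i * S i) - δ i * S i) := by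
      apply Finset.sum_congr rfl
      intro i hi
      have hik := Finset.ne_of_mem_erase hi
      simp only [he, if_neg hik]; ring
    have h3 := split (fun i => β * (a i * S i) - δ i * S i)
    rw [Finset.sum_sub_distrib, ← Finset.mul_sum] at h3
    rw [h2] at hold2
    simp only [he, if_true, hδk] at hold2 h3
    -- combine
    have hLk := hLY k
    have e1 : τ / Δ = 1 / (Δ + β * a k) := by rw [hτe]; field_simp
    rw [hLk, e1] at hle
    have hle2 : (∑ i, δ i * Y i) - Δ * κ + (Δ + β * a k) * G ≤
        (Δ + β * a k) * S k + Δ * Y k := by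
      have h5 := mul_le_mul_of_nonneg_left hle hden.le
      have e3 : (Δ + β * a k) * (1 / (Δ + β * a k) * ((∑ i, δ i * Y i) - Δ * κ) + G) =
        (∑ i, δ i * Y i) - Δ * κ + (Δ + β * a k) * G := by field_simp
      have e4 : (Δ + β * a k) * (S k + θ k * Y k) = (Δ + β * a k) * S k + Δ * Y k := by
        rw [← hτ, hτe]; field_simp
      rw [e3, e4] at h5
      exact h5
    linarith
  -- summation
  have hprodS : (∏ i, (∫⁻ x, EE (g i x) ∂ν) ^ a i) ^ (1 + β) = EE ((1 + β) * Λ) := by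
    simp_rw [hS, EE_rpow]
    rw [← EE_sum, EE_rpow]
  rw [hprodS, ← EE_add]
  refine (Finset.prod_le_prod' (fun i _ => hfac i)).trans ?_
  rw [← EE_sum]
  apply EE_mono
  set ε : I → ℝ := fun i => max (-(b i - a i)) 0 with hε
  have hεδ : ∀ i, b i - a i = δ i - ε i := by
    intro i
    simp only [hδdef, hε]
    rcases le_total (b i - a i) 0 with h | h
    · rw [max_eq_right h, max_eq_left (by linarith)]; ring
    · rw [max_eq_left h, max_eq_right (by linarith)]; ring
  have hεs : ∑ i, ε i = Δ := by
    have h1 : ∑ i, (b i - a i) = ∑ i, (δ i - ε i) := Finset.sum_congr rfl fun i _ => hεδ i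
    rw [Finset.sum_sub_distrib, Finset.sum_sub_distrib, hΔs] at h1
    linarith
  set X := (∑ i, δ i * Y i) - Δ * κ - β * Λ + (∑ i, δ i * S i) with hX
  have hεY : ∀ i, ε i * (X - Δ * S i) ≤ ε i * (Δ * Y i) := by
    intro i
    by_cases h : b i - a i < 0
    · exact mul_le_mul_of_nonneg_left (hlow i h) (le_max_right _ _)
    · have : ε i = 0 := max_eq_right (by linarith)
      simp [this]
  have hsumY : X - ∑ i, ε i * S i ≤ ∑ i, ε i * Y i := by
    have h1 := Finset.sum_le_sum fun i (_ : i ∈ Finset.univ) => hεY i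
    have h2 : ∑ i, ε i * (X - Δ * S i) = Δ * (X - ∑ i, ε i * S i) := by
      rw [mul_sub, ← hεs, Finset.sum_mul, Finset.mul_sum, ← Finset.sum_sub_distrib, hεs]
      apply Finset.sum_congr rfl
      intro i _; ring
    have h3 : ∑ i, ε i * (Δ * Y i) = Δ * ∑ i, ε i * Y i := by
      rw [Finset.mul_sum]
      apply Finset.sum_congr rfl
      intro i _; ring
    rw [h2, h3] at h1
    exact le_of_mul_le_mul_left h1 hΔ0
  have hfinal : ∑ i, (b i * S i + (b i - a i) * Y i + κ * ε i) =
      Λ + (∑ i, δ i * S i) - (∑ i, ε i * S i) + (∑ i, δ i * Y i) - (∑ i, ε i * Y i) + κ * Δ := by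
    rw [← hεs, Finset.mul_sum, hΛ, ← Finset.sum_add_distrib, ← Finset.sum_sub_distrib,
      ← Finset.sum_add_distrib, ← Finset.sum_sub_distrib, ← Finset.sum_add_distrib]
    apply Finset.sum_congr rfl
    intro i _
    have h1 := hεδ i
    have h2 : b i = a i + δ i - ε i := by linarith
    rw [h1]
    rw [h2]; ring
  rw [hfinal]
  linarith

end Extrap

namespace Extrap

/-! ### The main construction -/

def nuQ {d : ℕ} (Q : Cube d) : Measure (Fin d → ℝ) := (Q.vol)⁻¹ • volume.restrict Q.set

lemma vol_ne_zero {d : ℕ} (Q : Cube d) : Q.vol ≠ 0 := by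
  rw [cube_vol]
  exact pow_ne_zero _ (by simpa using Q.side_pos)

lemma vol_ne_top {d : ℕ} (Q : Cube d) : Q.vol ≠ ∞ := by
  rw [cube_vol]
  exact ENNReal.pow_ne_top ofReal_ne_top

instance nuQ_prob {d : ℕ} (Q : Cube d) : IsProbabilityMeasure (nuQ Q) := by
  constructor
  rw [nuQ, Measure.smul_apply, Measure.restrict_apply_univ, smul_eq_mul]
  exact ENNReal.inv_mul_cancel (vol_ne_zero Q) (vol_ne_top Q)

lemma nuQ_lint {d : ℕ} (Q : Cube d) (F : (Fin d → ℝ) → ℝ≥0∞) :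
    ∫⁻ x, F x ∂(nuQ Q) = (∫⁻ x in Q.set, F x) / Q.vol := by
  rw [nuQ, lintegral_smul_measure, smul_eq_mul, ENNReal.div_eq_inv_mul]

lemma nuQ_ess {d : ℕ} (Q : Cube d) (F : (Fin d → ℝ) → ℝ≥0∞) :
    essSup F (nuQ Q) = essSup F (volume.restrict Q.set) := by
  rw [nuQ]
  apply le_antisymm
  · exact essSup_mono_measure Measure.smul_absolutelyContinuous
  · exact essSup_mono_measure
      (Measure.absolutelyContinuous_smul (ENNReal.inv_ne_zero.2 (vol_ne_top Q)))

lemma nuQ_ac {d : ℕ} (Q : Cube d) : nuQ Q ≪ volume.restrict Q.set := by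
  rw [nuQ]
  exact Measure.smul_absolutelyContinuous

lemma LN_cover {d : ℕ} (Q Q' : Cube d) (hQ : Q.set ⊆ Q'.set) (hv : Q'.vol ≤ 6 ^ d * Q.vol)
    {b : ℝ} (hb : 0 ≤ b) (F : (Fin d → ℝ) → ℝ≥0∞) :
    LN b (nuQ Q) F ≤ (6 ^ d : ℝ≥0∞) ^ b * LN b (nuQ Q') F := by
  unfold LN
  split_ifs with h0
  · rw [nuQ_ess, nuQ_ess, h0, rpow_zero, one_mul]
    exact essSup_mono_measure (Measure.absolutelyContinuous_of_le (Measure.restrict_mono hQ le_rfl))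
  · rw [← ENNReal.mul_rpow_of_nonneg _ _ hb]
    refine ENNReal.rpow_le_rpow ?_ hb
    rw [nuQ_lint, nuQ_lint]
    have h1 : (Q.vol)⁻¹ ≤ 6 ^ d * (Q'.vol)⁻¹ := by
      rw [← div_eq_mul_inv, ENNReal.le_div_iff_mul_le (Or.inl (vol_ne_zero _)) (Or.inl (vol_ne_top _))]
      calc (Q.vol)⁻¹ * Q'.vol ≤ (Q.vol)⁻¹ * (6 ^ d * Q.vol) := by gcongr
        _ = 6 ^ d * ((Q.vol)⁻¹ * Q.vol) := by ring
        _ = _ := by rw [ENNReal.inv_mul_cancel (vol_ne_zero Q) (vol_ne_top Q), mul_one]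
    calc (∫⁻ x in Q.set, F x ^ (1 / b)) / Q.vol ≤ (∫⁻ x in Q'.set, F x ^ (1 / b)) * (6 ^ d * (Q'.vol)⁻¹) := by
          rw [div_eq_mul_inv]
          exact mul_le_mul' (lintegral_mono_set hQ) h1
      _ = _ := by rw [div_eq_mul_inv _ Q'.vol]; ring

lemma weightcore (d : ℕ) {I : Type*} [Fintype I] [DecidableEq I]
    (a b : I → ℝ) (ha : ∀ i, 0 < a i) (hb : ∀ i, 0 ≤ b i) (hab : ∑ i, a i = ∑ i, b i)
    (β : ℝ) (hβ : 0 < β) (hδ : ∀ i, b i - a i ≤ β * a i)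
    (hΔ0 : 0 < ∑ i, max (b i - a i) 0) :
    ∃ C : ℝ≥0∞, C ≠ 0 ∧ C ≠ ∞ ∧ ∀ u : I → (Fin d → ℝ) → ℝ, (∀ i, Measurable (u i)) →
      (∀ x, ∑ i, u i x = 0) →
      (⨆ Q : Cube d, ∏ i, LN (a i) (nuQ Q) (fun x => EE (u i x))) ≠ ∞ →
      ∀ h : (Fin d → ℝ) → ℝ≥0∞, Measurable h → (∀ x, h x ≠ 0) → ∫⁻ x, h x ≠ ∞ →
      ∃ η : (Fin d → ℝ) → ℝ, Measurable η ∧ (∀ᵐ x, h x ≤ EE (η x)) ∧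
        ∫⁻ x, EE (η x) ≤ 3 / 2 * ∫⁻ x, h x ∧
        ∀ Q : Cube d, ∏ i, LN (b i) (nuQ Q) (fun x => EE (u i x + (b i - a i) * η x)) ≤
          C * (⨆ Q : Cube d, ∏ i, LN (a i) (nuQ Q) (fun x => EE (u i x))) ^ (1 + β) := by
  set Δ := ∑ i, max (b i - a i) 0 with hΔ
  set θ : I → ℝ := fun i => if 0 < b i - a i then (b i - a i) / b i else Δ / (Δ + β * a i) with hθ
  have hθ0 : ∀ i, 0 < θ i := by
    intro i
    rw [hθ]; dsimp only
    split_ifs with h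
    · exact div_pos h (by linarith [ha i])
    · have := ha i; positivity
  have hθ1 : ∀ i, θ i < 1 := by
    intro i
    rw [hθ]; dsimp only
    split_ifs with h
    · rw [div_lt_one (by linarith [ha i])]; linarith [ha i]
    · have := mul_pos hβ (ha i)
      rw [div_lt_one (by linarith)]; linarith
  obtain ⟨K, hK0, hKt, hK⟩ := rdf d θ hθ0 hθ1
  obtain ⟨κ, rfl⟩ := EE_exists hK0 hKt
  have h6 : (6 ^ d : ℝ≥0∞) ≠ 0 := by simp
  have h6t : (6 ^ d : ℝ≥0∞) ≠ ∞ := by simp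
  refine ⟨(∏ i, (6 ^ d : ℝ≥0∞) ^ b i) * EE (2 * Δ * κ), ?_, ?_, ?_⟩
  · refine mul_ne_zero (Finset.prod_ne_zero_iff.2 fun i _ => ?_) (EE_ne_zero _)
    exact (ENNReal.rpow_pos (pos_iff_ne_zero.2 h6) h6t).ne'
  · refine ENNReal.mul_ne_top (ENNReal.prod_ne_top fun i _ => ?_) (EE_ne_top _)
    exact ENNReal.rpow_ne_top_of_nonneg (hb i) h6t
  intro u hu husum hfin h hh h0 hIntg
  set g : I → (Fin d → ℝ) → ℝ := fun i x => u i x / a i with hg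
  have hgm : ∀ i, Measurable (g i) := fun i => (hu i).div_const _
  have hag : ∀ i x, a i * g i x = u i x := fun i x => by
    rw [hg]; field_simp [(ha i).ne']
  obtain ⟨H, hHm, hhH, hHi, hHc⟩ := hK (fun i x => EE (g i x)) (fun i => EE_meas (hgm i))
    (fun i x => EE_ne_zero _) (fun i x => EE_ne_top _) h hh
  have hHfin : ∫⁻ x, H x ≠ ∞ := ne_top_of_le_ne_top (ENNReal.mul_ne_top (by finiteness) hIntg) hHi
  have hHae : ∀ᵐ x, H x < ∞ := ae_lt_top hHm hHfin
  have hη : ∀ᵐ x, EE (Real.log (H x).toReal) = H x := by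
    filter_upwards [hHae] with x hx
    exact EE_log (fun hz => h0 x (le_antisymm (hz ▸ hhH x) (zero_le))) hx.ne
  have hηm : Measurable fun x => Real.log (H x).toReal := by fun_prop
  have hηint : ∫⁻ x, EE (Real.log (H x).toReal) = ∫⁻ x, H x := lintegral_congr_ae hη
  refine ⟨fun x => Real.log (H x).toReal, hηm, ?_, hηint.le.trans hHi, ?_⟩
  · filter_upwards [hη] with x hx
    rw [hx]; exact hhH x
  set η : (Fin d → ℝ) → ℝ := fun x => Real.log (H x).toReal with hηdef
  set Aw := ⨆ Q : Cube d, ∏ i, LN (a i) (nuQ Q) (fun x => EE (u i x)) with hAw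
  have hLNa : ∀ (Q : Cube d) i, LN (a i) (nuQ Q) (fun x => EE (u i x)) =
      (∫⁻ x, EE (g i x) ∂(nuQ Q)) ^ a i := by
    intro Q i
    rw [LN, if_neg (ha i).ne']
    congr 1
    apply lintegral_congr
    intro x
    rw [EE_rpow]
    congr 1
    rw [hg]; ring
  have hgrid : ∀ α c, ∏ i, LN (b i) (nuQ (gcube α c)) (fun x => EE (u i x + (b i - a i) * η x)) ≤
      EE (2 * Δ * κ) * Aw ^ (1 + β) := by
    intro α c
    have hprod : ∏ i, (∫⁻ x, EE (g i x) ∂(nuQ (gcube α c))) ^ a i ≤ Aw := by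
      rw [← Finset.prod_congr rfl fun i _ => hLNa (gcube α c) i]
      exact le_iSup (fun Q : Cube d => ∏ i, LN (a i) (nuQ Q) (fun x => EE (u i x))) (gcube α c)
    have hnz : ∀ i, (∫⁻ x, EE (g i x) ∂(nuQ (gcube α c))) ≠ 0 := fun i => int_EE_ne_zero _ (hgm i)
    have hnt : ∀ i, (∫⁻ x, EE (g i x) ∂(nuQ (gcube α c))) ≠ ∞ := by
      intro i hi
      apply hfin
      rw [← top_le_iff]
      refine le_trans ?_ hprod
      rw [← Finset.mul_prod_erase _ _ (Finset.mem_univ i), hi, ENNReal.top_rpow_of_pos (ha i),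
        ENNReal.top_mul]
      refine Finset.prod_ne_zero_iff.2 fun j _ => ?_
      by_cases hj : (∫⁻ x, EE (g j x) ∂(nuQ (gcube α c))) = ∞
      · rw [hj, ENNReal.top_rpow_of_pos (ha j)]; simp
      · exact (ENNReal.rpow_pos (pos_iff_ne_zero.2 (hnz j)) hj).ne'
    have hηres : ∀ᵐ x ∂(volume.restrict (gset α c)), EE (η x) = H x := ae_restrict_of_ae hη
    have hHq : ∫⁻ x, EE (η x) ∂(nuQ (gcube α c)) ≠ ∞ := by
      rw [nuQ_lint]
      refine ENNReal.div_ne_top ?_ (vol_ne_zero _)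
      refine ne_top_of_le_ne_top hHfin ?_
      rw [← hηint]
      exact setLIntegral_le_lintegral _ _
    have hcc : ∀ i, ∀ᵐ x ∂(nuQ (gcube α c)),
        ((∫⁻ x, EE ((1 - θ i) * g i x + θ i * η x) ∂(nuQ (gcube α c))) /
        ∫⁻ x, EE (g i x) ∂(nuQ (gcube α c))) ^ (1 / θ i) * EE (g i x) ≤ EE κ * EE (η x) := by
      intro i
      have e1 : (∫⁻ x, EE ((1 - θ i) * g i x + θ i * η x) ∂(nuQ (gcube α c))) /
        (∫⁻ x, EE (g i x) ∂(nuQ (gcube α c))) =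
        (∫⁻ x in gset α c, EE (g i x) ^ (1 - θ i) * H x ^ θ i) / ∫⁻ x in gset α c, EE (g i x) := by
        rw [nuQ_lint, nuQ_lint, gcube_set]
        rw [div_eq_mul_inv _ (Cube.vol _), div_eq_mul_inv _ (Cube.vol _),
          ENNReal.mul_div_mul_right _ _ (ENNReal.inv_ne_zero.2 (vol_ne_top _))
          (ENNReal.inv_ne_top.2 (vol_ne_zero _))]
        congr 1
        apply lintegral_congr_ae
        filter_upwards [hηres] with x hx
        rw [← hx, EE_rpow, EE_rpow, ← EE_add]
      rw [e1]
      apply (nuQ_ac (gcube α c)).ae_le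
      rw [gcube_set]
      filter_upwards [hηres, ae_restrict_mem (gset_measurable α c)] with x hx hxQ
      rw [hx]
      exact hHc i α c x hxQ
    have := qlevel (nuQ (gcube α c)) a b ha hb hab β hβ hδ Δ hΔ hΔ0 θ (fun i => rfl) g hgm
      (fun x => by simp only [hag]; exact husum x) η hηm κ hnt hHq hcc
    simp only [hag] at this
    refine this.trans ?_
    gcongr
  intro Q
  obtain ⟨α, c, hsub, hv⟩ := cover Q
  rw [← gcube_set] at hsub
  calc ∏ i, LN (b i) (nuQ Q) (fun x => EE (u i x + (b i - a i) * η x))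
      ≤ ∏ i, ((6 ^ d : ℝ≥0∞) ^ b i *
        LN (b i) (nuQ (gcube α c)) (fun x => EE (u i x + (b i - a i) * η x))) :=
        Finset.prod_le_prod' fun i _ => LN_cover Q _ hsub hv (hb i) _
    _ ≤ _ := by
      rw [Finset.prod_mul_distrib, mul_assoc]
      gcongr
      exact hgrid α c

lemma LN_const {E : Type*} [MeasurableSpace E] {P : ℝ} (hP : 0 ≤ P) {μ : Measure E}
    {F : E → ℝ≥0∞} {n : ℝ≥0∞} (hn : n ≠ ∞) {η : E → ℝ} (B : ℝ≥0∞)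
    (hB : ∫⁻ x, EE (η x) ∂μ ≤ B) (hF : ∀ᵐ x ∂μ, F x ≤ n * EE (P * η x)) :
    LN P μ F ≤ n * B ^ P := by
  refine (LN_mono hP hF).trans ?_
  unfold LN
  split_ifs with h0
  · subst h0
    simp only [zero_mul, EE_zero, mul_one, rpow_zero]
    exact essSup_le_of_ae_le _ (Filter.Eventually.of_forall fun x => le_rfl)
  · have hP' : 0 < P := lt_of_le_of_ne hP (Ne.symm h0)
    calc (∫⁻ x, (n * EE (P * η x)) ^ (1 / P) ∂μ) ^ P
        = (n ^ (1 / P) * ∫⁻ x, EE (η x) ∂μ) ^ P := by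
          rw [← lintegral_const_mul' _ _ (ENNReal.rpow_ne_top_of_nonneg (by positivity) hn)]
          congr 1
          apply lintegral_congr
          intro x
          rw [ENNReal.mul_rpow_of_nonneg _ _ (by positivity), EE_rpow]
          congr 2
          field_simp
      _ ≤ (n ^ (1 / P) * B) ^ P := by gcongr
      _ = _ := by
          rw [ENNReal.mul_rpow_of_nonneg _ _ hP, ← ENNReal.rpow_mul, one_div_mul_cancel h0,
            ENNReal.rpow_one]

lemma LN_down {E : Type*} [MeasurableSpace E] {P T : ℝ} (hP : 0 ≤ P) (hPT : P ≤ T) {μ : Measure E}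
    {F : E → ℝ≥0∞} (hF : Measurable F) (hn : LN P μ F ≠ ∞) {η : E → ℝ} (hη : Measurable η)
    (B : ℝ≥0∞)
    (hB : ∫⁻ x, EE (η x) ∂μ ≤ B) :
    LN T μ (fun x => F x * EE ((T - P) * η x)) ≤ LN P μ F * B ^ (T - P) := by
  rcases hPT.eq_or_lt with rfl | hlt
  · simp [EE_zero]
  rcases hP.eq_or_lt with rfl | hP'
  · simp only [sub_zero]
    apply LN_const hPT hn B hB
    rw [LN, if_pos rfl]
    filter_upwards [ENNReal.ae_le_essSup F] with x hx
    gcongr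
  · have hT : 0 < T := hP'.trans hlt
    have hold := ENNReal.lintegral_mul_le_Lp_mul_Lq μ
      (f := fun x => F x ^ (1 / T)) (g := fun x => EE ((T - P) * η x) ^ (1 / T))
      (p := T / P) (q := T / (T - P))
      (Real.holderConjugate_iff.2 ⟨by rw [lt_div_iff₀ hP']; linarith, by
        have : T - P ≠ 0 := by linarith
        field_simp; ring⟩) (hF.pow_const _).aemeasurable ((EE_meas (by fun_prop)).pow_const _).aemeasurable
    rw [LN, LN, if_neg hT.ne', if_neg hP'.ne']
    have hT' := hT.ne'
    have hP'' := hP'.ne'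
    have hTP : T - P ≠ 0 := by linarith
    calc _ ≤ ((∫⁻ x, (F x ^ (1 / T)) ^ (T / P) ∂μ) ^ (1 / (T / P)) *
          (∫⁻ x, (EE ((T - P) * η x) ^ (1 / T)) ^ (T / (T - P)) ∂μ) ^ (1 / (T / (T - P)))) ^ T := by
          refine ENNReal.rpow_le_rpow (le_trans (le_of_eq ?_) hold) hT.le
          apply lintegral_congr
          intro x
          rw [ENNReal.mul_rpow_of_nonneg _ _ (by positivity)]
          rfl
      _ = (∫⁻ x, F x ^ (1 / P) ∂μ) ^ P * (∫⁻ x, EE (η x) ∂μ) ^ (T - P) := by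
          rw [ENNReal.mul_rpow_of_nonneg _ _ hT.le, ← ENNReal.rpow_mul, ← ENNReal.rpow_mul]
          have e1 : ∀ x, (F x ^ (1 / T)) ^ (T / P) = F x ^ (1 / P) := fun x => by
            rw [← ENNReal.rpow_mul]; congr 1; field_simp
          have e2 : ∀ x, (EE ((T - P) * η x) ^ (1 / T)) ^ (T / (T - P)) = EE (η x) := fun x => by
            rw [EE_rpow, EE_rpow]; congr 1; field_simp
          simp only [e1, e2]
          congr 2 <;> field_simp
      _ ≤ _ := by
          gcongr

lemma core (d m : ℕ) (hm : 1 ≤ m) {I : Type*} [Fintype I] [DecidableEq I]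
    (hcard : Fintype.card I = m + 1)
    (a b : I → ℝ) (ha : ∀ i, 0 < a i) (hb : ∀ i, 0 ≤ b i)
    (P T : I → ℝ) (hP : ∀ i, 0 ≤ P i) (hT : ∀ i, 0 ≤ T i) (hPT : ∀ i, b i - a i = P i - T i)
    (S : ℝ) (hPS : ∑ i, P i = S) (hTS : ∑ i, T i = S)
    (β : ℝ) (hβ : 0 < β) (hδ : ∀ i, b i - a i ≤ β * a i)
    (hΔ0 : ∃ i, a i < b i) :
    ∃ C : ℝ≥0∞, C ≠ 0 ∧ C ≠ ∞ ∧ ∀ u : I → (Fin d → ℝ) → ℝ, (∀ i, Measurable (u i)) →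
      (∀ x, ∑ i, u i x = 0) →
      (⨆ Q : Cube d, ∏ i, LN (a i) (nuQ Q) (fun x => EE (u i x))) ≠ ∞ →
      ∀ F : I → (Fin d → ℝ) → ℝ≥0∞, (∀ i, Measurable (F i)) →
      (∀ i, LN (P i) volume (F i) ≠ ∞) →
      ∃ η : (Fin d → ℝ) → ℝ, Measurable η ∧
        ∏ i, LN (T i) volume (fun x => F i x * EE (-((b i - a i) * η x))) ≤
          (2 : ℝ≥0∞) ^ ((m : ℝ) ^ 2 * S) * ∏ i, LN (P i) volume (F i) ∧
        ∀ Q : Cube d, ∏ i, LN (b i) (nuQ Q) (fun x => EE (u i x + (b i - a i) * η x)) ≤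
          C * (⨆ Q : Cube d, ∏ i, LN (a i) (nuQ Q) (fun x => EE (u i x))) ^ (1 + β) := by
  have hab : ∑ i, a i = ∑ i, b i := by
    have : ∑ i, (b i - a i) = 0 := by
      simp only [hPT, Finset.sum_sub_distrib, hPS, hTS, sub_self]
    rw [Finset.sum_sub_distrib] at this
    linarith
  have hΔ : 0 < ∑ i, max (b i - a i) 0 := by
    obtain ⟨i, hi⟩ := hΔ0
    exact Finset.sum_pos' (fun i _ => le_max_right _ _)
      ⟨i, Finset.mem_univ i, lt_max_of_lt_left (by linarith)⟩
  obtain ⟨C, hC0, hCt, hC⟩ := weightcore d a b ha hb hab β hβ hδ hΔ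
  refine ⟨C, hC0, hCt, ?_⟩
  intro u hu hus hfin F hF hn
  set n : I → ℝ≥0∞ := fun i => LN (P i) volume (F i) with hndef
  set up : Finset I := Finset.univ.filter fun i => T i < P i with hup
  have hupcard : up.card ≤ m := by
    by_contra! hlt
    have : up = Finset.univ := by
      apply Finset.eq_univ_of_card
      have := Finset.card_le_univ up
      omega
    have h2 : ∀ i, T i < P i := fun i => by
      have : i ∈ up := this ▸ Finset.mem_univ i
      simpa [hup] using this
    have : ∑ i, T i < ∑ i, P i := Finset.sum_lt_sum_of_nonempty
      (Finset.univ_nonempty_iff.2 (Fintype.card_pos_iff.1 (by omega))) fun i _ => h2 i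
    linarith
  obtain ⟨e, he0, hem, hei⟩ := exists_pos_lintegral_lt_of_sigmaFinite
    (volume : Measure (Fin d → ℝ)) (ε := 3⁻¹) (by simp)
  set h : (Fin d → ℝ) → ℝ≥0∞ := fun x => ∑ i ∈ up, (F i x / n i) ^ (1 / P i) + e x with hh
  have hhm : Measurable h := by
    refine Measurable.add (Finset.measurable_sum up fun i _ => ?_) hem.coe_nnreal_ennreal
    exact ((hF i).div_const _).pow_const _
  have hPpos : ∀ i ∈ up, 0 < P i := fun i hi => by
    simp [hup] at hi; linarith [hT i]
  have hFz : ∀ i ∈ up, n i = 0 → ∀ᵐ x, F i x = 0 := by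
    intro i hi h0
    have hp := hPpos i hi
    simp only [hndef, LN, if_neg hp.ne'] at h0
    rw [ENNReal.rpow_eq_zero_iff_of_pos hp, lintegral_eq_zero_iff ((hF i).pow_const _)] at h0
    filter_upwards [h0] with x hx
    simpa [ENNReal.rpow_eq_zero_iff_of_pos (inv_pos.2 hp)] using hx
  have hone : ∀ i ∈ up, ∫⁻ x, (F i x / n i) ^ (1 / P i) ≤ 1 := by
    intro i hi
    have hp := hPpos i hi
    by_cases h0 : n i = 0
    · have : ∫⁻ x, (F i x / n i) ^ (1 / P i) = ∫⁻ x : Fin d → ℝ, 0 := by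
        apply lintegral_congr_ae
        filter_upwards [hFz i hi h0] with x hx
        rw [hx, ENNReal.zero_div, ENNReal.zero_rpow_of_pos (by positivity)]
      rw [this]; simp
    · have e1 : ∀ x, (F i x / n i) ^ (1 / P i) = F i x ^ (1 / P i) * (n i ^ (1 / P i))⁻¹ := fun x => by
        rw [ENNReal.div_rpow_of_nonneg _ _ (by positivity), div_eq_mul_inv]
      simp only [e1]
      have h1 : n i ^ (1 / P i) = ∫⁻ x, F i x ^ (1 / P i) := by
        simp only [hndef, LN, if_neg hp.ne']
        rw [← ENNReal.rpow_mul, mul_one_div_cancel hp.ne', ENNReal.rpow_one]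
      rw [lintegral_mul_const _ ((hF i).pow_const _), ← h1]
      exact ENNReal.mul_inv_le_one _
  have hhFin : ∫⁻ x, h x ≤ m + 3⁻¹ := by
    rw [hh]
    simp only
    rw [lintegral_add_right _ hem.coe_nnreal_ennreal, lintegral_finsetSum _ fun i _ =>
      ((hF i).div_const _).pow_const _]
    refine add_le_add ?_ hei.le
    calc ∑ i ∈ up, ∫⁻ x, (F i x / n i) ^ (1 / P i) ≤ ∑ i ∈ up, 1 := Finset.sum_le_sum hone
      _ = (up.card : ℝ≥0∞) := by simp
      _ ≤ m := by exact_mod_cast hupcard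
  obtain ⟨η, hηm, hηh, hηi, hηQ⟩ := hC u hu hus hfin h hhm
    (fun x => by
      have := he0 x
      simp only [hh, ne_eq, add_eq_zero, not_and]
      intro _; exact_mod_cast this.ne')
    (ne_top_of_le_ne_top (by simp) hhFin)
  refine ⟨η, hηm, ?_, hηQ⟩
  set B : ℝ≥0∞ := 2 ^ (m ^ 2) with hB
  have hB1 : 1 ≤ B := one_le_pow₀ (by norm_num)
  have hηB : ∫⁻ x, EE (η x) ≤ B := by
    refine hηi.trans ?_
    calc 3 / 2 * ∫⁻ x, h x ≤ 3 / 2 * (m + 3⁻¹) := by gcongr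
      _ ≤ 2 * m := by
        have e1 : (3 / 2 * (m + 3⁻¹) : ℝ≥0∞) = ENNReal.ofReal (3 / 2 * (m + 3⁻¹)) := by
          rw [ENNReal.ofReal_mul (by norm_num), ENNReal.ofReal_add (by positivity) (by positivity),
            ENNReal.ofReal_div_of_pos (by norm_num), ENNReal.ofReal_inv_of_pos (by norm_num)]
          simp
        have e2 : (2 * m : ℝ≥0∞) = ENNReal.ofReal (2 * m) := by
          rw [ENNReal.ofReal_mul (by norm_num)]; simp
        rw [e1, e2]
        apply ENNReal.ofReal_le_ofReal
        have : (1 : ℝ) ≤ m := by exact_mod_cast hm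
        linarith
      _ ≤ B := by
        have : 2 * m ≤ 2 ^ (m ^ 2) := by
          have h1 : m < 2 ^ m := Nat.lt_two_pow_self
          have h2 : 2 * m ≤ 2 ^ m := by
            obtain ⟨k, rfl⟩ : ∃ k, m = k + 1 := ⟨m - 1, by omega⟩
            have : k < 2 ^ k := Nat.lt_two_pow_self
            rw [pow_succ]; omega
          exact h2.trans (Nat.pow_le_pow_right (by norm_num) (by nlinarith))
        rw [hB]
        exact_mod_cast this
  have each : ∀ i, LN (T i) volume (fun x => F i x * EE (-((b i - a i) * η x))) ≤
      n i * B ^ T i := by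
    intro i
    by_cases hi : T i < P i
    · apply LN_const (hT i) (hn i) B hηB
      have hi' : i ∈ up := by simp [hup, hi]
      have hp := hPpos i hi'
      have key : ∀ᵐ x, F i x ≤ n i * EE (P i * η x) := by
        by_cases h0 : n i = 0
        · filter_upwards [hFz i hi' h0] with x hx
          rw [hx]; exact zero_le
        · filter_upwards [hηh] with x hx
          have h1 : (F i x / n i) ^ (1 / P i) ≤ EE (η x) := by
            refine le_trans ?_ hx
            rw [hh]
            refine le_trans ?_ le_self_add
            exact Finset.single_le_sum (f := fun i => (F i x / n i) ^ (1 / P i))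
              (fun _ _ => zero_le) hi'
          have h2 := ENNReal.rpow_le_rpow h1 hp.le
          rw [← ENNReal.rpow_mul, one_div_mul_cancel hp.ne', ENNReal.rpow_one, EE_rpow,
            ENNReal.div_le_iff h0 (hn i)] at h2
          rw [mul_comm]; exact h2
      filter_upwards [key] with x hx
      calc _ ≤ n i * EE (P i * η x) * EE (-((b i - a i) * η x)) := by gcongr
        _ = _ := by
          rw [mul_assoc, ← EE_add, hPT]
          congr 2
          ring
    · push Not at hi
      have := LN_down (hP i) hi (hF i) (hn i) hηm B hηB
      have e1 : (fun x => F i x * EE (-((b i - a i) * η x))) =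
          fun x => F i x * EE ((T i - P i) * η x) := by
        funext x; rw [hPT]; congr 2; ring
      rw [e1]
      refine this.trans ?_
      gcongr
      linarith [hP i]
  calc _ ≤ ∏ i, (n i * B ^ T i) := Finset.prod_le_prod' fun i _ => each i
    _ = _ := by
      rw [Finset.prod_mul_distrib, mul_comm]
      congr 1
      have hprod : ∏ i, B ^ T i = B ^ S := by
        obtain ⟨y, hy⟩ := EE_exists (x := B) (by simp [hB]) (by simp [hB])
        simp only [hy, EE_rpow]
        rw [← EE_sum, ← Finset.sum_mul, hTS]
      rw [hprod, hB, ← ENNReal.rpow_natCast, ← ENNReal.rpow_mul]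
      push_cast
      rfl

end Extrap

namespace Extrap

/-! ### Translation to the frozen statement -/

lemma eNorm_eq {E : Type*} [MeasurableSpace E] (μ : Measure E) (F : E → ℝ≥0∞) {x : ℝ≥0∞}
    (hx : x ≠ ∞) : eNorm x⁻¹ μ F = LN x.toReal μ F := by
  unfold eNorm LN
  by_cases h0 : x = 0
  · simp [h0]
  · rw [if_neg (by simpa using h0), if_neg (by simp [ENNReal.toReal_eq_zero_iff, h0, hx])]
    simp [ENNReal.toReal_inv]

lemma avg_eq {d : ℕ} (Q : Cube d) (F : (Fin d → ℝ) → ℝ≥0∞) {x : ℝ≥0∞}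
    (hx : x ≠ ∞) : avg x⁻¹ F Q = LN x.toReal (nuQ Q) F := by
  rw [← eNorm_eq _ _ hx]
  unfold avg eNorm
  rw [nuQ_ess, nuQ_lint]

def ufam {d m : ℕ} (l : Fin m → (Fin d → ℝ) → ℝ) : Option (Fin m) → (Fin d → ℝ) → ℝ :=
  fun i x => Option.elim i (∑ j, l j x) (fun j => -l j x)

lemma ofReal_exp_inv (x : ℝ) : ENNReal.ofReal (Real.exp x)⁻¹ = EE (-x) := by
  rw [EE, Real.exp_neg]

lemma aConst_eq {d m : ℕ} (p r : Fin m → ℝ≥0∞) (s : ℝ≥0∞) (l : Fin m → (Fin d → ℝ) → ℝ)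
    (a : Option (Fin m) → ℝ) (hr : ∀ j, (r j)⁻¹ - (p j)⁻¹ ≠ ∞) (hs : (∑ j, (p j)⁻¹) - s⁻¹ ≠ ∞)
    (ha : ∀ j, a (some j) = ((r j)⁻¹ - (p j)⁻¹).toReal)
    (ha0 : a none = ((∑ j, (p j)⁻¹) - s⁻¹).toReal) :
    aConst p r s (fun j x => Real.exp (l j x)) =
      ⨆ Q : Cube d, ∏ i, LN (a i) (nuQ Q) (fun x => EE (ufam l i x)) := by
  unfold aConst
  congr 1
  funext Q
  rw [Fintype.prod_option, mul_comm, avg_eq Q _ hs, ha0]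
  congr 1
  · congr 1
    funext x
    simp only [ufam, Option.elim]
    rw [EE, Real.exp_sum]
  · apply Finset.prod_congr rfl
    intro j _
    rw [avg_eq Q _ (hr j), ha]
    congr 1
    funext x
    exact ofReal_exp_inv _

lemma norm_eq {d m : ℕ} (p : Fin m → ℝ≥0∞) (q : ℝ≥0∞) (l : Fin m → (Fin d → ℝ) → ℝ)
    (f : Fin m → (Fin d → ℝ) → ℂ) (g : (Fin d → ℝ) → ℂ)
    (P : Option (Fin m) → ℝ) (hp : ∀ j, (p j)⁻¹ ≠ ∞) (hq : q⁻¹ - ∑ j, (p j)⁻¹ ≠ ∞)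
    (hP : ∀ j, P (some j) = ((p j)⁻¹).toReal) (hP0 : P none = (q⁻¹ - ∑ j, (p j)⁻¹).toReal) :
    (∀ j, wNorm (p j) (fun x => Real.exp (l j x)) (nn (f j)) = LN (P (some j)) volume
      (fun x => nn ((Option.elim (some j) g f)) x * EE (-(ufam l (some j) x)))) ∧
    wNorm (q⁻¹ - ∑ j, (p j)⁻¹)⁻¹ (fun x => (∏ j, Real.exp (l j x))⁻¹) (nn g) =
      LN (P none) volume (fun x => nn ((Option.elim none g f)) x * EE (-(ufam l none x))) := by
  constructor
  · intro j
    rw [wNorm, ← inv_inv (p j), eNorm_eq _ _ (hp j), hP]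
    congr 1
    funext x
    simp only [ufam, Option.elim, neg_neg]
    rfl
  · rw [wNorm, eNorm_eq _ _ hq, hP0]
    congr 1
    funext x
    simp only [ufam, Option.elim]
    rw [← Real.exp_sum, ofReal_exp_inv]

end Extrap

open Extrap
/-- quantitative multilinear extrapolation of weights. -/
theorem statement4 (d m : ℕ) (hd : 1 ≤ d) (hm : 1 ≤ m)
    (r : Fin m → ℝ≥0∞) (hr : ∀ j, 0 < r j ∧ r j ≠ ∞)
    (q s : ℝ≥0∞) (hq : 0 < q) (hq' : q ≠ ∞) (hqs : q < s)
    (t : Fin m → ℝ≥0∞) (hrt : ∀ j, r j ≤ t j)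
    (hqt : q ≤ (∑ j, (t j)⁻¹)⁻¹) (hts : (∑ j, (t j)⁻¹)⁻¹ ≤ s)
    (p : Fin m → ℝ≥0∞) (hrp : ∀ j, r j < p j)
    (hqp : q ≤ (∑ j, (p j)⁻¹)⁻¹) (hps : (∑ j, (p j)⁻¹)⁻¹ < s) :
    ∃ C : ℝ≥0∞, 0 < C ∧ C ≠ ∞ ∧
      ∀ (w : Fin m → (Fin d → ℝ) → ℝ),
        (∀ j, Measurable (w j)) → (∀ j x, 0 < w j x) →
        aConst p r s w ≠ ∞ →
        ∀ (f : Fin m → (Fin d → ℝ) → ℂ) (g : (Fin d → ℝ) → ℂ),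
          (∀ j, Measurable (f j)) →
          (∀ j, wNorm (p j) (w j) (nn (f j)) ≠ ∞) →
          Measurable g →
          wNorm (q⁻¹ - ∑ j, (p j)⁻¹)⁻¹ (fun x => (∏ j, w j x)⁻¹) (nn g) ≠ ∞ →
          ∃ W : Fin m → (Fin d → ℝ) → ℝ,
            (∀ j, Measurable (W j)) ∧ (∀ j x, 0 < W j x) ∧
            aConst t r s W ≠ ∞ ∧
            (∏ j, wNorm (t j) (W j) (nn (f j))) *
                wNorm (q⁻¹ - ∑ j, (t j)⁻¹)⁻¹ (fun x => (∏ j, W j x)⁻¹) (nn g) ≤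
              (2 : ℝ≥0∞) ^ ((m : ℝ) ^ 2 / q.toReal) *
                (∏ j, wNorm (p j) (w j) (nn (f j))) *
                wNorm (q⁻¹ - ∑ j, (p j)⁻¹)⁻¹ (fun x => (∏ j, w j x)⁻¹) (nn g) ∧
            aConst t r s W ≤ C * aConst p r s w ^
              ((max (⨆ j, ((r j)⁻¹ - (t j)⁻¹) / ((r j)⁻¹ - (p j)⁻¹))
                (((∑ j, (t j)⁻¹) - s⁻¹) / ((∑ j, (p j)⁻¹) - s⁻¹))).toReal) := by
  have : Nonempty (Fin m) := ⟨⟨0, hm⟩⟩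
  -- finiteness and positivity
  have hrf : ∀ j, (r j)⁻¹ ≠ ∞ := fun j => ENNReal.inv_ne_top.2 (hr j).1.ne'
  have hpr : ∀ j, (p j)⁻¹ < (r j)⁻¹ := fun j => ENNReal.inv_lt_inv.2 (hrp j)
  have htr : ∀ j, (t j)⁻¹ ≤ (r j)⁻¹ := fun j => ENNReal.inv_le_inv.2 (hrt j)
  have hpf : ∀ j, (p j)⁻¹ ≠ ∞ := fun j => ne_top_of_lt (hpr j)
  have htf : ∀ j, (t j)⁻¹ ≠ ∞ := fun j => ne_top_of_le_ne_top (hrf j) (htr j)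
  have hqf : q⁻¹ ≠ ∞ := ENNReal.inv_ne_top.2 hq.ne'
  have hsf : s⁻¹ ≠ ∞ := ENNReal.inv_ne_top.2 (hq.trans hqs).ne'
  have hpq : ∑ j, (p j)⁻¹ ≤ q⁻¹ := by
    have := ENNReal.inv_le_inv.2 hqp; rwa [inv_inv] at this
  have htq : ∑ j, (t j)⁻¹ ≤ q⁻¹ := by
    have := ENNReal.inv_le_inv.2 hqt; rwa [inv_inv] at this
  have hsp : s⁻¹ < ∑ j, (p j)⁻¹ := by
    have := ENNReal.inv_lt_inv.2 hps; rwa [inv_inv] at this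
  have hst : s⁻¹ ≤ ∑ j, (t j)⁻¹ := by
    have := ENNReal.inv_le_inv.2 hts; rwa [inv_inv] at this
  have hpsf : ∑ j, (p j)⁻¹ ≠ ∞ := ne_top_of_le_ne_top hqf hpq
  have htsf : ∑ j, (t j)⁻¹ ≠ ∞ := ne_top_of_le_ne_top hqf htq
  -- real exponents
  obtain ⟨aE, haE⟩ : ∃ aE : Option (Fin m) → ℝ≥0∞, aE = fun i =>
    Option.elim i ((∑ j, (p j)⁻¹) - s⁻¹) (fun j => (r j)⁻¹ - (p j)⁻¹) := ⟨_, rfl⟩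
  obtain ⟨bE, hbE⟩ : ∃ bE : Option (Fin m) → ℝ≥0∞, bE = fun i =>
    Option.elim i ((∑ j, (t j)⁻¹) - s⁻¹) (fun j => (r j)⁻¹ - (t j)⁻¹) := ⟨_, rfl⟩
  have haE0 : ∀ i, aE i ≠ 0 := by
    subst haE
    rintro (_ | j)
    · exact (tsub_pos_of_lt hsp).ne'
    · exact (tsub_pos_of_lt (hpr j)).ne'
  have haEt : ∀ i, aE i ≠ ∞ := by
    subst haE
    rintro (_ | j)
    · exact ENNReal.sub_ne_top hpsf
    · exact ENNReal.sub_ne_top (hrf j)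
  have hbEt : ∀ i, bE i ≠ ∞ := by
    subst hbE
    rintro (_ | j)
    · exact ENNReal.sub_ne_top htsf
    · exact ENNReal.sub_ne_top (hrf j)
  set M := max (⨆ j, ((r j)⁻¹ - (t j)⁻¹) / ((r j)⁻¹ - (p j)⁻¹))
                (((∑ j, (t j)⁻¹) - s⁻¹) / ((∑ j, (p j)⁻¹) - s⁻¹)) with hM
  have hMi : ∀ i, bE i / aE i ≤ M := by
    subst haE hbE
    rintro (_ | j)
    · exact le_max_right _ _
    · exact le_max_of_le_left (le_iSup (fun j => ((r j)⁻¹ - (t j)⁻¹) / ((r j)⁻¹ - (p j)⁻¹)) j)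
  have hMt : M ≠ ∞ := by
    have hle : M ≤ ∑ i, bE i / aE i := by
      have hs1 := fun i => Finset.single_le_sum (f := fun i => bE i / aE i) (fun _ _ => zero_le)
        (Finset.mem_univ i)
      subst haE hbE
      exact max_le (iSup_le fun j => hs1 (some j)) (hs1 none)
    exact ne_top_of_le_ne_top (ENNReal.sum_ne_top.2 fun i _ =>
      ENNReal.div_ne_top (hbEt i) (haE0 i)) hle
  set a : Option (Fin m) → ℝ := fun i => (aE i).toReal with ha
  set b : Option (Fin m) → ℝ := fun i => (bE i).toReal with hb
  have hapos : ∀ i, 0 < a i := fun i => ENNReal.toReal_pos (haE0 i) (haEt i)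
  have hbnn : ∀ i, 0 ≤ b i := fun i => ENNReal.toReal_nonneg
  have hbM : ∀ i, b i ≤ M.toReal * a i := fun i => by
    have := ENNReal.toReal_mono hMt (hMi i)
    rwa [ENNReal.toReal_div, div_le_iff₀ (hapos i)] at this
  set P : Option (Fin m) → ℝ := fun i =>
    Option.elim i (q⁻¹ - ∑ j, (p j)⁻¹).toReal (fun j => ((p j)⁻¹).toReal) with hP
  set T : Option (Fin m) → ℝ := fun i =>
    Option.elim i (q⁻¹ - ∑ j, (t j)⁻¹).toReal (fun j => ((t j)⁻¹).toReal) with hT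
  have hPnn : ∀ i, 0 ≤ P i := by rintro (_ | j) <;> exact ENNReal.toReal_nonneg
  have hTnn : ∀ i, 0 ≤ T i := by rintro (_ | j) <;> exact ENNReal.toReal_nonneg
  have hPsum : ∑ i, P i = (q⁻¹).toReal := by
    rw [Fintype.sum_option]
    simp only [hP, Option.elim]
    rw [ENNReal.toReal_sub_of_le hpq hqf, ENNReal.toReal_sum fun j _ => hpf j]; ring
  have hTsum : ∑ i, T i = (q⁻¹).toReal := by
    rw [Fintype.sum_option]
    simp only [hT, Option.elim]
    rw [ENNReal.toReal_sub_of_le htq hqf, ENNReal.toReal_sum fun j _ => htf j]; ring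
  have hba : ∀ i, b i - a i = P i - T i := by
    subst haE hbE
    rintro (_ | j)
    · simp only [ha, hb, hP, hT, Option.elim]
      rw [ENNReal.toReal_sub_of_le htq hqf, ENNReal.toReal_sub_of_le hpq hqf,
        ENNReal.toReal_sub_of_le hst htsf, ENNReal.toReal_sub_of_le hsp.le hpsf]
      ring
    · simp only [ha, hb, hP, hT, Option.elim]
      rw [ENNReal.toReal_sub_of_le (hpr j).le (hrf j), ENNReal.toReal_sub_of_le (htr j) (hrf j)]
      ring
  have hsum0 : ∑ i, (b i - a i) = 0 := by
    simp only [hba, Finset.sum_sub_distrib, hPsum, hTsum, sub_self]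
  by_cases hex : ∃ i, a i < b i
  · -- the main case
    have hβ : 0 < M.toReal - 1 := by
      obtain ⟨i, hi⟩ := hex
      have h1 := hbM i
      have h2 := hapos i
      by_contra! hcon
      nlinarith
    obtain ⟨C, hC0, hCt, hC⟩ := core d m hm (I := Option (Fin m)) (by simp) a b hapos hbnn P T hPnn hTnn
      hba _ hPsum hTsum (M.toReal - 1) hβ (fun i => by linarith [hbM i]) hex
    refine ⟨C, pos_iff_ne_zero.2 hC0, hCt, ?_⟩
    intro w hwm hw0 hwA f g hf hfn hg hgn
    obtain ⟨l, hl⟩ : ∃ l : Fin m → (Fin d → ℝ) → ℝ, l = fun j x => Real.log (w j x) := ⟨_, rfl⟩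
    have hlm : ∀ j, Measurable (l j) := fun j => by rw [hl]; exact (hwm j).log
    have hwl : w = fun j x => Real.exp (l j x) := by
      funext j x; rw [hl]; exact (Real.exp_log (hw0 j x)).symm
    clear hl
    subst hwl
    have hum : ∀ i, Measurable (ufam l i) := by
      rintro (_ | j)
      · exact Finset.measurable_sum Finset.univ fun j _ => hlm j
      · exact (hlm j).neg
    have hus : ∀ x, ∑ i, ufam l i x = 0 := fun x => by
      rw [Fintype.sum_option]; simp [ufam]
    have hAp := aConst_eq (d := d) p r s l a (fun j => ENNReal.sub_ne_top (hrf j))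
      (ENNReal.sub_ne_top hpsf) (fun j => by simp only [ha, haE, Option.elim]) (by simp only [ha, haE, Option.elim])
    rw [hAp] at hwA
    obtain ⟨hN1, hN0⟩ := norm_eq (d := d) p q l f g P hpf (ENNReal.sub_ne_top hqf)
      (fun j => rfl) rfl
    set F : Option (Fin m) → (Fin d → ℝ) → ℝ≥0∞ := fun i x =>
      nn (Option.elim i g f) x * EE (-(ufam l i x)) with hF
    have hFm : ∀ i, Measurable (F i) := by
      intro i
      refine Measurable.mul ?_ (EE_meas (hum i).neg)
      unfold nn
      rcases i with (_ | j)
      · exact hg.nnnorm.coe_nnreal_ennreal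
      · exact (hf j).nnnorm.coe_nnreal_ennreal
    obtain ⟨η, hηm, hη1, hη2⟩ := hC (ufam l) hum hus hwA F hFm (by
      rintro (_ | j)
      · rw [hN0] at hgn; exact hgn
      · have := hfn j; rw [hN1] at this; exact this)
    obtain ⟨L, hL⟩ : ∃ L : Fin m → (Fin d → ℝ) → ℝ,
      L = fun j x => l j x - (b (some j) - a (some j)) * η x := ⟨_, rfl⟩
    have hLm : ∀ j, Measurable (L j) := fun j => by
      rw [hL]; exact (hlm j).sub (hηm.const_mul _)
    have huL : ∀ i x, ufam L i x = ufam l i x + (b i - a i) * η x := by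
      rintro (_ | j) x
      · rw [Fintype.sum_option] at hsum0
        simp only [ufam, Option.elim, hL]
        rw [Finset.sum_sub_distrib, ← Finset.sum_mul]
        linear_combination (-η x) * hsum0
      · simp only [ufam, Option.elim, hL]; ring
    have hAt := aConst_eq (d := d) t r s L b (fun j => ENNReal.sub_ne_top (hrf j))
      (ENNReal.sub_ne_top htsf) (fun j => by simp only [hb, hbE, Option.elim]) (by simp only [hb, hbE, Option.elim])
    have hbound : aConst t r s (fun j x => Real.exp (L j x)) ≤
        C * aConst p r s (fun j x => Real.exp (l j x)) ^ M.toReal := by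
      rw [hAt, hAp]
      apply iSup_le
      intro Q
      have := hη2 Q
      simp only [← huL] at this
      rwa [add_sub_cancel] at this
    refine ⟨fun j x => Real.exp (L j x), fun j => (hLm j).exp, fun j x => Real.exp_pos _, ?_, ?_, hbound⟩
    · refine ne_top_of_le_ne_top ?_ hbound
      rw [hAp]
      exact ENNReal.mul_ne_top hCt (ENNReal.rpow_ne_top_of_nonneg ENNReal.toReal_nonneg hwA)
    · obtain ⟨hM1, hM0⟩ := norm_eq (d := d) t q L f g T htf (ENNReal.sub_ne_top hqf)
        (fun j => rfl) rfl
      simp only [hM1, hM0, hN1, hN0]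
      rw [Fintype.prod_option, Fintype.prod_option, ENNReal.toReal_inv, ← div_eq_mul_inv] at hη1
      have hFL : ∀ i, (fun x => F i x * EE (-((b i - a i) * η x))) =
          fun x => nn (Option.elim i g f) x * EE (-(ufam L i x)) := by
        intro i
        funext x
        rw [huL, hF, neg_add, EE_add, mul_assoc]
      simp only [hFL] at hη1
      rw [mul_comm, mul_assoc]
      refine hη1.trans (le_of_eq ?_)
      congr 1
      rw [mul_comm]
  · -- the trivial case
    push Not at hex
    have heq : ∀ i, b i - a i = 0 := by
      have := (Finset.sum_eq_zero_iff_of_nonpos (s := Finset.univ) (f := fun i => b i - a i)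
        fun i _ => by linarith [hex i]).1 hsum0
      exact fun i => this i (Finset.mem_univ i)
    have htp : t = p := by
      funext j
      have h1 := hba (some j)
      rw [heq] at h1
      simp only [hP, hT, Option.elim] at h1
      have h2 : (p j)⁻¹.toReal = (t j)⁻¹.toReal := by linarith
      rw [ENNReal.toReal_eq_toReal_iff' (hpf j) (htf j)] at h2
      exact (inv_injective h2).symm
    have hM1 : M = 1 := by
      rw [hM, htp]
      subst haE
      have h1 : ∀ j, ((r j)⁻¹ - (p j)⁻¹) / ((r j)⁻¹ - (p j)⁻¹) = 1 := fun j =>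
        ENNReal.div_self (haE0 (some j)) (haEt (some j))
      have h2 : (∑ j, (p j)⁻¹ - s⁻¹) / (∑ j, (p j)⁻¹ - s⁻¹) = 1 :=
        ENNReal.div_self (haE0 none) (haEt none)
      simp only [h1, h2, iSup_const, max_self]
    refine ⟨1, one_pos, by simp, ?_⟩
    intro w hwm hw0 hwA f g hf hfn hg hgn
    refine ⟨w, hwm, hw0, ?_, ?_, ?_⟩
    · rwa [htp]
    · rw [htp, mul_assoc]
      refine le_mul_of_one_le_left (zero_le) ?_
      exact ENNReal.one_le_rpow (by norm_num) (by
        have : 0 < q.toReal := ENNReal.toReal_pos hq.ne' hq'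
        have : (0:ℝ) < m := by exact_mod_cast hm
        positivity)
    · rw [htp, hM1]; simp

end
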